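/- arXiv:1002.0628 — 3 statements merged into one kernel-verified Lean document; each statement's English description precedes it below -/
import Mathlib

section
/- Let 𝒞 be an r-balanced coherent configuration. If the homogeneous component 𝒞_X is commutative for some fiber X (i.e., c_{RS}^T = c_{SR}^T for all R,S,T ∈ ℛ_X), then |𝒫(𝒞)| = r. In particular, if r ≤ 5 then |𝒫(𝒞)| = r. -/
open scoped Classical

namespace CCPaper

variable {V : Type*}

/-- The diagonal relation `Δ_X = {(x,x) : x ∈ X}` on a subset `X ⊆ V`. -/
def diag (X : Set V) : Set (V × V) := {p : V × V | p.1 ∈ X ∧ p.1 = p.2}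

/-- The transpose `R^t = {(v,u) : (u,v) ∈ R}` of a relation. -/
def transp (R : Set (V × V)) : Set (V × V) := Prod.swap ⁻¹' R

/-- The intersection number `|{w : (p.1,w) ∈ R, (w,p.2) ∈ S}|` at a pair `p`. -/
noncomputable def iNum (R S : Set (V × V)) (p : V × V) : ℕ :=
  Nat.card {w : V | (p.1, w) ∈ R ∧ (w, p.2) ∈ S}

/-- `ℛ` is a coherent configuration (scheme) on the finite set `V`:
(C1) `ℛ` consists of nonempty relations partitioning `V × V`;
(C2) the diagonal is a union of relations of `ℛ`;
(C3) `ℛ` is closed under transposition;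
(C4) intersection numbers are constant on each relation of `ℛ`. -/
def IsCC [Fintype V] (ℛ : Set (Set (V × V))) : Prop :=
  (∀ R ∈ ℛ, R.Nonempty) ∧
  (∀ p : V × V, ∃! R, R ∈ ℛ ∧ p ∈ R) ∧
  (∀ R ∈ ℛ, (∃ p ∈ R, p.1 = p.2) → ∀ p ∈ R, p.1 = p.2) ∧
  (∀ R ∈ ℛ, transp R ∈ ℛ) ∧
  (∀ R ∈ ℛ, ∀ S ∈ ℛ, ∀ T ∈ ℛ, ∀ p ∈ T, ∀ q ∈ T, iNum R S p = iNum R S q)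

/-- A fiber of the configuration: a nonempty `X ⊆ V` with `Δ_X ∈ ℛ`. -/
def IsFiber [Fintype V] (ℛ : Set (Set (V × V))) (X : Set V) : Prop :=
  X.Nonempty ∧ diag X ∈ ℛ

/-- `ℛ_{X,Y}`, the set of basis relations contained in `X × Y`. -/
def relsBtw [Fintype V] (ℛ : Set (Set (V × V))) (X Y : Set V) : Set (Set (V × V)) :=
  {R | R ∈ ℛ ∧ R ⊆ X ×ˢ Y}

/-- Out-degree `d_R = |R_out(x)|` (computed at a chosen point of `R`;
for a basis relation of a scheme this is independent of the point). -/
noncomputable def outDeg (R : Set (V × V)) : ℕ :=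
  if h : R.Nonempty then Nat.card {y : V | (h.choose.1, y) ∈ R} else 0

/-- In-degree `e_R = |R_in(y)|` (computed at a chosen point of `R`). -/
noncomputable def inDeg (R : Set (V × V)) : ℕ :=
  if h : R.Nonempty then Nat.card {x : V | (x, h.choose.2) ∈ R} else 0

/-- The structure constant `c_{RS}^T` (computed at a chosen pair of `T`). -/
noncomputable def sConst (R S T : Set (V × V)) : ℕ :=
  if h : T.Nonempty then iNum R S h.choose else 0

/-- The complex product `RS = {T ∈ ℛ : c_{RS}^T > 0}`. -/
def cProd [Fintype V] (ℛ : Set (Set (V × V))) (R S : Set (V × V)) : Set (Set (V × V)) :=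
  {T | T ∈ ℛ ∧ 0 < sConst R S T}

/-- A relation is thin if `d_R = e_R = 1`. -/
def IsThin (R : Set (V × V)) : Prop := outDeg R = 1 ∧ inDeg R = 1

/-- `ℛ` is `r`-balanced: `|ℛ_{X,Y}| = r` for all fibers `X, Y`. -/
def IsBalancedWith [Fintype V] (ℛ : Set (Set (V × V))) (r : ℕ) : Prop :=
  ∀ X Y : Set V, IsFiber ℛ X → IsFiber ℛ Y → Nat.card (relsBtw ℛ X Y) = r

/-- `ℛ` is balanced: `|ℛ_{X,Y}|` is the same for all pairs of fibers. -/
def IsBalanced [Fintype V] (ℛ : Set (Set (V × V))) : Prop := ∃ r : ℕ, IsBalancedWith ℛ r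

/-- An `(m,n,r)`-scheme: a coherent configuration which is `r`-balanced, all of whose
fibers have size `m`, and which has exactly `n` fibers. -/
def IsMNRScheme [Fintype V] (ℛ : Set (Set (V × V))) (m n r : ℕ) : Prop :=
  IsCC ℛ ∧ IsBalancedWith ℛ r ∧ (∀ X : Set V, IsFiber ℛ X → Nat.card X = m) ∧
    Nat.card {X : Set V | IsFiber ℛ X} = n

/-- A scheme is reduced if no basis relation between distinct fibers is thin. -/
def IsReduced [Fintype V] (ℛ : Set (Set (V × V))) : Prop :=
  ∀ X Y : Set V, IsFiber ℛ X → IsFiber ℛ Y → X ≠ Y → ∀ R ∈ relsBtw ℛ X Y, ¬ IsThin R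

/-- A (possibly empty) union of fibers. -/
def IsFiberUnion [Fintype V] (ℛ : Set (Set (V × V))) (U : Set V) : Prop :=
  ∃ F : Set (Set V), (∀ X ∈ F, IsFiber ℛ X) ∧ U = ⋃₀ F

/-- The adjacency matrix of a relation. -/
noncomputable def adjMat [Fintype V] (R : Set (V × V)) : Matrix V V ℂ :=
  fun u v => if (u, v) ∈ R then 1 else 0

/-- The diagonal idempotent `I_X` of a subset `X ⊆ V`. -/
noncomputable def idMat [Fintype V] (X : Set V) : Matrix V V ℂ :=
  fun u v => if u = v ∧ u ∈ X then 1 else 0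

/-- The adjacency algebra `𝒜(𝒞)`, the subalgebra of `Mat_V(ℂ)` spanned by the
adjacency matrices of the basis relations. -/
noncomputable def adjAlg [Fintype V] [DecidableEq V] (ℛ : Set (Set (V × V))) :
    Subalgebra ℂ (Matrix V V ℂ) :=
  Algebra.adjoin ℂ (adjMat '' ℛ)

/-- `P` is a central primitive idempotent of the (multiplicatively closed) set of
matrices `S`: `P ∈ S` is a nonzero idempotent commuting with everything in `S`, which is
not the sum of two nonzero orthogonal central idempotents of `S`. -/
def IsCPIin [Fintype V] (S : Set (Matrix V V ℂ)) (P : Matrix V V ℂ) : Prop :=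
  P ∈ S ∧ P ≠ 0 ∧ P * P = P ∧ (∀ Q ∈ S, P * Q = Q * P) ∧
  ∀ Q₁ Q₂ : Matrix V V ℂ, Q₁ ∈ S → Q₂ ∈ S →
    Q₁ * Q₁ = Q₁ → Q₂ * Q₂ = Q₂ →
    (∀ M ∈ S, Q₁ * M = M * Q₁) → (∀ M ∈ S, Q₂ * M = M * Q₂) →
    Q₁ * Q₂ = 0 → Q₂ * Q₁ = 0 → P = Q₁ + Q₂ → Q₁ = 0 ∨ Q₂ = 0

/-- `𝒫(𝒞)`: the set of central primitive idempotents of the adjacency algebra. -/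
def CPIs [Fintype V] [DecidableEq V] (ℛ : Set (Set (V × V))) : Set (Matrix V V ℂ) :=
  {P | IsCPIin (adjAlg ℛ : Set (Matrix V V ℂ)) P}

/-- The adjacency algebra `I_X · 𝒜(𝒞) · I_X` of the homogeneous component `𝒞_X`,
as a subset of `Mat_V(ℂ)`. -/
def compAlgSet [Fintype V] [DecidableEq V] (ℛ : Set (Set (V × V))) (X : Set V) :
    Set (Matrix V V ℂ) :=
  {M | ∃ N ∈ adjAlg ℛ, M = idMat X * N * idMat X}

/-- `𝒫(𝒞_X)`: the central primitive idempotents of the homogeneous component `𝒞_X`. -/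
def CPIsComp [Fintype V] [DecidableEq V] (ℛ : Set (Set (V × V))) (X : Set V) :
    Set (Matrix V V ℂ) :=
  {P | IsCPIin (compAlgSet ℛ X) P}

/-- The degree `n_P` of a central primitive idempotent `P` of the algebra (given as the
set `S`): the positive integer with `n_P ^ 2 = dim_ℂ (S · P)`. -/
noncomputable def degOf [Fintype V] [DecidableEq V] (S : Set (Matrix V V ℂ))
    (P : Matrix V V ℂ) : ℕ :=
  Nat.sqrt (Module.finrank ℂ
    (Submodule.span ℂ {M : Matrix V V ℂ | ∃ a ∈ S, M = a * P}))


theorem aux_idem_trace {n : ℕ} (E : Matrix (Fin n) (Fin n) ℂ) (h : E * E = E) :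
    ∃ k : ℕ, E.trace = k ∧ (k = 0 → E = 0) := by
  have hi : IsIdempotentElem (Matrix.toLin' E) := by
    unfold IsIdempotentElem
    rw [Module.End.mul_eq_comp, ← Matrix.toLin'_mul, h]
  have hp := LinearMap.IsIdempotentElem.isProj_range _ hi
  refine ⟨_, by rw [← Matrix.trace_toLin'_eq]; exact hp.trace, ?_⟩
  intro h0
  have h1 : LinearMap.range (Matrix.toLin' E) = ⊥ := Submodule.finrank_eq_zero.mp h0
  have h2 : Matrix.toLin' E = 0 := LinearMap.range_eq_bot.mp h1
  simpa using h2

theorem aux_comm_trace {n : ℕ} (E : Matrix (Fin n) (Fin n) ℂ) (h : E * E = E)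
    (hc : ∀ M N : Matrix (Fin n) (Fin n) ℂ, E * M * E * N * E = E * N * E * M * E) :
    E.trace ^ 3 = E.trace := by
  have key : ∀ i j q : Fin n, E i i * E j j * E q q = E i j * E j q * E q i := by
    intro i j q
    have := congrFun (congrFun (hc (Matrix.single i j 1) (Matrix.single j q 1)) i) q
    have e : ∀ a b c d : Fin n, (E * Matrix.single a b (1:ℂ) * E * Matrix.single c d (1:ℂ) * E) i q
        = E i a * E b c * E d q := by
      intro a b c d
      rw [Matrix.mul_apply, Finset.sum_eq_single d]
      · rw [Matrix.mul_single_apply_same, Matrix.mul_apply, Finset.sum_eq_single b]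
        · simp
        · intro x _ hx
          rw [Matrix.mul_single_apply_of_ne _ _ _ _ _ hx]; simp
        · simp
      · intro x _ hx
        rw [Matrix.mul_single_apply_of_ne _ _ _ _ _ hx]; simp
      · simp
    rw [e, e] at this
    rw [this]; ring
  calc E.trace ^ 3 = ∑ i, ∑ j, ∑ q, E i i * E j j * E q q := by
        rw [pow_succ, pow_two, Matrix.trace, Finset.sum_mul_sum, Finset.sum_mul]
        refine Finset.sum_congr rfl fun i _ => ?_
        rw [Finset.sum_mul]
        refine Finset.sum_congr rfl fun j _ => ?_
        rw [Finset.mul_sum]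
        rfl
    _ = ∑ i, (E * E * E) i i := by
        refine Finset.sum_congr rfl fun i _ => ?_
        simp only [Matrix.mul_apply, Finset.sum_mul]
        rw [Finset.sum_comm]
        exact Finset.sum_congr rfl fun j _ => Finset.sum_congr rfl fun q _ => key _ _ _
    _ = E.trace := by rw [h, h]; rfl

theorem aux_trace_pi {n : ℕ} {d : Fin n → ℕ} (e f : ∀ i, Matrix (Fin (d i)) (Fin (d i)) ℂ) :
    LinearMap.trace ℂ (∀ i, Matrix (Fin (d i)) (Fin (d i)) ℂ)
      (LinearMap.mulLeft ℂ e ∘ₗ LinearMap.mulRight ℂ f) = ∑ i, (e i).trace * (f i).trace := by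
  rw [LinearMap.trace_eq_matrix_trace ℂ (Pi.basis fun i => Matrix.stdBasis ℂ (Fin (d i)) (Fin (d i)))]
  rw [Matrix.trace, Fintype.sum_sigma]
  refine Finset.sum_congr rfl fun i _ => ?_
  rw [Matrix.trace, Matrix.trace, Finset.sum_mul_sum, Fintype.sum_prod_type]
  refine Finset.sum_congr rfl fun a _ => Finset.sum_congr rfl fun b _ => ?_
  simp [LinearMap.toMatrix_apply, Matrix.stdBasis_eq_single, Pi.basis_repr, Pi.basis_apply]
  have hr : ∀ M : Matrix (Fin (d i)) (Fin (d i)) ℂ,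
      ((Matrix.stdBasis ℂ (Fin (d i)) (Fin (d i))).repr M) (a, b) = M a b := by
    intro M; rfl
  rw [hr, ← Matrix.mul_assoc, Matrix.mul_apply, Finset.sum_eq_single b]
  · simp
  · intro x _ hx
    rw [Matrix.mul_single_apply_of_ne _ _ _ _ _ hx]; simp
  · simp

theorem aux_integral_trace {n : ℕ} (M : Matrix (Fin n) (Fin n) ℂ) (h : IsIntegral ℤ M) :
    IsIntegral ℤ M.trace := by
  rw [Matrix.trace_eq_sum_roots_charpoly]
  refine IsIntegral.multiset_sum ?_
  intro μ hμ
  have hμ' : M.charpoly.IsRoot μ := (Polynomial.mem_roots'.mp hμ).2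
  obtain ⟨p, hp, hp0⟩ := h
  refine ⟨p, hp, ?_⟩
  have h1 : Module.End.HasEigenvalue (Matrix.toLin' M) μ := by
    rw [Module.End.hasEigenvalue_iff_isRoot_charpoly]
    simpa using hμ'
  have h2 : (Polynomial.aeval M (p.map (algebraMap ℤ ℂ))) = 0 := by
    rw [Polynomial.aeval_map_algebraMap]; exact hp0
  have h3 : minpoly ℂ M ∣ p.map (algebraMap ℤ ℂ) := minpoly.dvd _ _ h2
  have h4 : (minpoly ℂ M).IsRoot μ := by
    have := Module.End.isRoot_of_hasEigenvalue h1
    rwa [Matrix.minpoly_toLin'] at this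
  have := h4.dvd h3
  rw [Polynomial.IsRoot, Polynomial.eval_map] at this
  exact this

theorem aux_functional {n : ℕ} {d : Fin n → ℕ} [∀ i, NeZero (d i)]
    (φ : (∀ i, Matrix (Fin (d i)) (Fin (d i)) ℂ) →ₗ[ℂ] ℂ) (hφ : ∀ a b, φ (a * b) = φ (b * a)) :
    ∃ m : Fin n → ℂ, ∀ a, φ a = ∑ i, m i * (a i).trace := by
  refine ⟨fun i => φ (Pi.single i (Matrix.single 0 0 1)), fun a => ?_⟩
  have h0 : ∀ i (p q : Fin (d i)), φ (Pi.single i (Matrix.single p q 1)) =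
      if p = q then φ (Pi.single i (Matrix.single 0 0 1)) else 0 := by
    intro i p q
    have e1 : (Pi.single i (Matrix.single p q (1:ℂ)) : ∀ i, Matrix (Fin (d i)) (Fin (d i)) ℂ) =
      Pi.single i (Matrix.single p 0 1) * Pi.single i (Matrix.single 0 q 1) := by
      rw [← Pi.single_mul]; simp
    rw [e1, hφ, ← Pi.single_mul]
    split_ifs with h
    · subst h; simp
    · rw [Matrix.single_mul_single_of_ne]; simp
      exact fun h' => h h'.symm
  have h1 : a = ∑ i, ∑ p, ∑ q, (a i p q) • (Pi.single i (Matrix.single p q (1:ℂ)) : ∀ i, Matrix (Fin (d i)) (Fin (d i)) ℂ) := by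
    conv_lhs => rw [← Finset.univ_sum_single a]
    refine Finset.sum_congr rfl fun i _ => ?_
    conv_lhs => rw [Matrix.matrix_eq_sum_single (a i)]
    simp only [← Pi.single_smul, Matrix.smul_single, smul_eq_mul, mul_one]
    rw [← LinearMap.single_apply (R := ℂ)]
    simp [map_sum]
  conv_lhs => rw [h1]
  simp only [map_sum, map_smul, smul_eq_mul, Matrix.trace, Matrix.diag, Finset.mul_sum]
  refine Finset.sum_congr rfl fun i _ => ?_
  refine Finset.sum_congr rfl fun p _ => ?_
  rw [Finset.sum_eq_single p]
  · rw [h0, if_pos rfl, mul_comm]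
  · intro q _ hq; rw [h0, if_neg (Ne.symm hq), mul_zero]
  · simp

theorem aux_scalar {n : ℕ} [NeZero n] (E : Matrix (Fin n) (Fin n) ℂ) (h : E * E = E)
    (hc : ∀ M, E * M = M * E) : E = 0 ∨ E = 1 := by
  obtain ⟨c, rfl⟩ := Matrix.mem_range_scalar_iff_commute_single'.mpr
    (fun i j => (hc (Matrix.single i j 1)).symm)
  rw [← map_mul] at h
  have h' : c * c = c := by
    have := congrFun (congrFun h 0) 0
    simpa using this
  rcases IsIdempotentElem.iff_eq_zero_or_one.mp h' with rfl | rfl <;> simp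

open scoped ComplexOrder in
theorem aux_semisimple {V : Type*} [Fintype V] [DecidableEq V] (A : Subalgebra ℂ (Matrix V V ℂ))
    (hA : ∀ a ∈ A, Matrix.conjTranspose a ∈ A) : IsSemisimpleRing A := by
  have : IsArtinianRing A := IsArtinianRing.of_finite ℂ A
  rw [IsArtinianRing.isSemisimpleRing_iff_jacobson, eq_bot_iff]
  intro x hx
  have hn := IsArtinianRing.isNilpotent_jacobson_bot (R := A)
  rw [Ideal.jacobson_bot] at hn
  obtain ⟨k, hk⟩ := hn
  let y : A := ⟨_, hA x.1 x.2⟩ * x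
  have hy : y ∈ Ring.jacobson A := Ideal.mul_mem_left _ _ hx
  have hyk : y ^ k = 0 := by
    have := Ideal.pow_mem_pow hy k
    rw [hk] at this; simpa using this
  have hyk' : (Matrix.conjTranspose x.1 * x.1) ^ k = 0 := by
    have := congrArg Subtype.val hyk
    simpa [y] using this
  have hH : (Matrix.conjTranspose x.1 * x.1).IsHermitian := Matrix.isHermitian_conjTranspose_mul_self _
  have main : ∀ j : ℕ, (Matrix.conjTranspose x.1 * x.1) ^ (2 ^ j) = 0 → Matrix.conjTranspose x.1 * x.1 = 0 := by
    intro j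
    induction j with
    | zero => intro h; simpa using h
    | succ j ih =>
      intro h
      apply ih
      have hh : ((Matrix.conjTranspose x.1 * x.1) ^ (2 ^ j)).IsHermitian := hH.pow _
      rw [pow_succ, mul_comm, two_mul, pow_add] at h
      nth_rewrite 1 [← hh.eq] at h
      exact Matrix.conjTranspose_mul_self_eq_zero.mp h
  have h0 := main k (by
    have : k ≤ 2 ^ k := Nat.lt_two_pow_self.le
    rw [← Nat.sub_add_cancel this, pow_add, hyk', mul_zero])
  have := Matrix.conjTranspose_mul_self_eq_zero.mp h0
  simpa using this

theorem aux_cpi_card {V : Type*} [Fintype V] [DecidableEq V] (A : Subalgebra ℂ (Matrix V V ℂ))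
    {n : ℕ} {d : Fin n → ℕ} [∀ i, NeZero (d i)]
    (φ : A ≃ₐ[ℂ] (∀ i, Matrix (Fin (d i)) (Fin (d i)) ℂ)) :
    Nat.card {P | IsCPIin (A : Set (Matrix V V ℂ)) P} = n := by
  have h01 : ∀ Q : A, Q * Q = Q → (∀ M : A, Q * M = M * Q) → ∀ i, φ Q i = 0 ∨ φ Q i = 1 := by
    intro Q hQ hc i
    apply aux_scalar
    · rw [← Pi.mul_apply, ← map_mul, hQ]
    · intro M
      have := hc (φ.symm (Pi.single i M))
      have := congrFun (congrArg φ this) i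
      simpa using this
  let s : Fin n → A := fun i => φ.symm (Pi.single i 1)
  have hs0 : ∀ i, s i ≠ 0 := by
    intro i h
    have : (Pi.single i 1 : ∀ i, Matrix (Fin (d i)) (Fin (d i)) ℂ) = 0 := by
      simpa only [s, map_eq_zero_iff _ φ.symm.injective] using h
    have := congrFun this i
    simp at this
  have hss : ∀ i, s i * s i = s i := by
    intro i
    simp only [s, ← map_mul, ← Pi.single_mul, mul_one]
  have hsc : ∀ i (M : A), s i * M = M * s i := by
    intro i M
    apply φ.injective
    ext j : 1
    by_cases hj : j = i
    · subst hj; simp [s]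
    · simp [s, hj]
  have hmem : ∀ i, ((s i : A) : Matrix V V ℂ) ∈ {P | IsCPIin (A : Set (Matrix V V ℂ)) P} := by
    intro i
    refine ⟨(s i).2, by simpa using hs0 i, by exact_mod_cast hss i, ?_, ?_⟩
    · intro Q hQ
      exact congrArg Subtype.val (hsc i ⟨Q, hQ⟩)
    · intro Q₁ Q₂ m1 m2 i1 i2 c1 c2 o1 o2 hsum
      have a1 := h01 ⟨Q₁, m1⟩ (Subtype.ext i1) (fun M => Subtype.ext (c1 M M.2))
      have a2 := h01 ⟨Q₂, m2⟩ (Subtype.ext i2) (fun M => Subtype.ext (c2 M M.2))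
      have hsum' : s i = ⟨Q₁, m1⟩ + ⟨Q₂, m2⟩ := Subtype.ext hsum
      have hsum2 : ∀ j, (Pi.single i 1 : ∀ i, Matrix (Fin (d i)) (Fin (d i)) ℂ) j
          = φ ⟨Q₁, m1⟩ j + φ ⟨Q₂, m2⟩ j := by
        intro j
        have := congrFun (congrArg φ hsum') j
        rw [map_add] at this
        simpa only [s, AlgEquiv.apply_symm_apply, Pi.add_apply] using this
      have h2 : ∀ j, ((1 : Matrix (Fin (d j)) (Fin (d j)) ℂ) + 1) ≠ 0 := by
        intro j h
        have := congrFun (congrFun h 0) 0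
        norm_num at this
      have hoff : ∀ j, j ≠ i → φ ⟨Q₁, m1⟩ j = 0 ∧ φ ⟨Q₂, m2⟩ j = 0 := by
        intro j hj
        have := hsum2 j
        rw [Pi.single_eq_of_ne hj] at this
        rcases a1 j with e1 | e1 <;> rcases a2 j with e2 | e2 <;> rw [e1, e2] at this
        · exact ⟨e1, e2⟩
        · simp at this
        · simp at this
        · exact absurd this.symm (h2 j)
      have hi := hsum2 i
      rw [Pi.single_eq_same] at hi
      have fin0 : ∀ (Q) (m : Q ∈ A), φ ⟨Q, m⟩ i = 0 → (∀ j, j ≠ i → φ ⟨Q, m⟩ j = 0) → Q = 0 := by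
        intro Q m h1 h2
        have : φ ⟨Q, m⟩ = 0 := by
          ext j : 1
          by_cases hj : j = i
          · subst hj; simpa using h1
          · simpa using h2 j hj
        have : (⟨Q, m⟩ : A) = 0 := by simpa using this
        exact congrArg Subtype.val this
      rcases a1 i with e1 | e1
      · exact Or.inl (fin0 _ m1 e1 fun j hj => (hoff j hj).1)
      · right
        refine fin0 _ m2 ?_ fun j hj => (hoff j hj).2
        rw [e1] at hi
        simpa using hi
  have hbij : Function.Bijective (fun i => (⟨_, hmem i⟩ : {P | IsCPIin (A : Set (Matrix V V ℂ)) P})) := by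
    constructor
    · intro i j hij
      have h1 : s i = s j := Subtype.ext (Subtype.mk.inj hij)
      have h2 := congrFun (φ.symm.injective h1) i
      by_contra hne
      rw [Pi.single_eq_same, Pi.single_eq_of_ne hne] at h2
      simp at h2
    · rintro ⟨P, hP, hP0, hPP, hPc, hPp⟩
      have a := h01 ⟨P, hP⟩ (Subtype.ext hPP) (fun M => Subtype.ext (hPc M M.2))
      have hex : ∃ i, φ ⟨P, hP⟩ i ≠ 0 := by
        by_contra! h
        have : φ ⟨P, hP⟩ = 0 := funext h
        have : (⟨P, hP⟩ : A) = 0 := by simpa using this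
        exact hP0 (congrArg Subtype.val this)
      obtain ⟨i, hi⟩ := hex
      have hi1 := (a i).resolve_left hi
      have hPs : (⟨P, hP⟩ : A) * s i = s i := by
        apply φ.injective
        ext j : 1
        by_cases hj : j = i
        · subst hj; simp [s, hi1]
        · simp [s, hj]
      have hsP : s i * (⟨P, hP⟩ : A) = s i := by rw [hsc, hPs]
      have hPP' : (⟨P, hP⟩ : A) * ⟨P, hP⟩ = ⟨P, hP⟩ := Subtype.ext hPP
      have hPc' : ∀ M : A, (⟨P, hP⟩ : A) * M = M * ⟨P, hP⟩ := fun M => Subtype.ext (hPc M M.2)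
      let q : A := ⟨P, hP⟩ - s i
      have q1 : q * q = q := by
        simp only [q, sub_mul, mul_sub, hPs, hsP, hss, hPP']; simp
      have q2 : ∀ M, q * M = M * q := by
        intro M; simp only [q, sub_mul, mul_sub, hsc, hPc']
      have q3 : s i * q = 0 := by simp only [q, mul_sub, hsP, hss, sub_self]
      have q4 : q * s i = 0 := by simp only [q, sub_mul, hPs, hss, sub_self]
      have q5 : (⟨P, hP⟩ : A) = s i + q := by simp [q]
      refine ⟨i, ?_⟩
      have := hPp (s i) q (s i).2 q.2 (congrArg Subtype.val (hss i)) (congrArg Subtype.val q1)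
        (fun M hM => congrArg Subtype.val (hsc i ⟨M, hM⟩))
        (fun M hM => congrArg Subtype.val (q2 ⟨M, hM⟩))
        (congrArg Subtype.val q3) (congrArg Subtype.val q4) (congrArg Subtype.val q5)
      rcases this with h | h
      · exact absurd (Subtype.ext h) (hs0 i)
      · apply Subtype.ext
        have h' : q = 0 := Subtype.ext h
        rw [h', add_zero] at q5
        exact (congrArg Subtype.val q5).symm
  rw [← Nat.card_eq_of_bijective _ hbij, Nat.card_fin]

theorem aux_mem_adjAlg {V : Type*} [Fintype V] [DecidableEq V] {ℛ : Set (Set (V × V))}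
    (hCC : IsCC ℛ) (M : Matrix V V ℂ) :
    M ∈ adjAlg ℛ ↔ ∀ R ∈ ℛ, ∀ p ∈ R, ∀ q ∈ R, M p.1 p.2 = M q.1 q.2 := by
  obtain ⟨h1, h2, h3, h4, h5⟩ := hCC
  choose cls hcls huniq using h2
  simp only at hcls huniq
  constructor
  · intro hM
    unfold adjAlg at hM
    induction hM using Algebra.adjoin_induction with
    | mem x hx =>
      obtain ⟨S, hS, rfl⟩ := hx
      intro R hR p hp q hq
      have : (p ∈ S) = (q ∈ S) := by
        have e1 := huniq p R ⟨hR, hp⟩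
        have e2 := huniq q R ⟨hR, hq⟩
        apply propext
        constructor
        · intro h
          have := huniq p S ⟨hS, h⟩
          rwa [this, ← e1]
        · intro h
          have := huniq q S ⟨hS, h⟩
          rwa [this, ← e2]
      simp only [adjMat, Prod.mk.eta, this]
    | algebraMap r =>
      intro R hR p hp q hq
      have : (p.1 = p.2) = (q.1 = q.2) := propext
        ⟨fun h => h3 R hR ⟨p, hp, h⟩ q hq, fun h => h3 R hR ⟨q, hq, h⟩ p hp⟩
      simp only [Matrix.algebraMap_matrix_apply, this]
    | add x y _ _ hx hy =>
      intro R hR p hp q hq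
      rw [Matrix.add_apply, Matrix.add_apply, hx R hR p hp q hq, hy R hR p hp q hq]
    | mul x y _ _ hx hy =>
      intro T hT p hp q hq
      have key : ∀ M : Matrix V V ℂ, (∀ R ∈ ℛ, ∀ p ∈ R, ∀ q ∈ R, M p.1 p.2 = M q.1 q.2) →
          ∃ m : Set (V × V) → ℂ, ∀ u v, M u v = m (cls (u, v)) := by
        intro M hM
        refine ⟨fun R => if h : R.Nonempty then M h.choose.1 h.choose.2 else 0, ?_⟩
        intro u v
        have hne : (cls (u, v)).Nonempty := ⟨_, (hcls (u, v)).2⟩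
        simp only [dif_pos hne]
        exact hM _ (hcls (u, v)).1 (u, v) (hcls (u, v)).2 _ hne.choose_spec
      obtain ⟨a, ha⟩ := key x hx
      obtain ⟨b, hb⟩ := key y hy
      have ex : ∀ p : V × V, (x * y) p.1 p.2 =
          ∑ RS : Set (V × V) × Set (V × V), if RS.1 ∈ ℛ ∧ RS.2 ∈ ℛ then
            (iNum RS.1 RS.2 p : ℂ) * (a RS.1 * b RS.2) else 0 := by
        intro p
        rw [Matrix.mul_apply, ← Finset.sum_fiberwise Finset.univ
          (fun w => (cls (p.1, w), cls (w, p.2)))]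
        refine Finset.sum_congr rfl fun RS _ => ?_
        split_ifs with hRS
        · have : (iNum RS.1 RS.2 p) =
            (Finset.univ.filter (fun w => (cls (p.1, w), cls (w, p.2)) = RS)).card := by
            rw [iNum, Nat.card_eq_fintype_card, ← Set.toFinset_card]
            congr 1
            ext w
            simp only [Set.mem_toFinset, Set.mem_ofPred_eq, Finset.mem_filter, Finset.mem_univ,
              true_and, Prod.ext_iff]
            constructor
            · rintro ⟨w1, w2⟩
              exact ⟨(huniq _ _ ⟨hRS.1, w1⟩).symm, (huniq _ _ ⟨hRS.2, w2⟩).symm⟩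
            · rintro ⟨w1, w2⟩
              rw [← w1, ← w2]
              exact ⟨(hcls _).2, (hcls _).2⟩
          rw [this, ← nsmul_eq_mul, ← Finset.sum_const]
          refine Finset.sum_congr rfl fun w hw => ?_
          have hw := (Finset.mem_filter.mp hw).2
          rw [ha, hb, ← hw]
        · refine Finset.sum_eq_zero fun w hw => ?_
          have hw := (Finset.mem_filter.mp hw).2
          exact absurd (hw ▸ ⟨(hcls _).1, (hcls _).1⟩) hRS
      rw [ex, ex]
      refine Finset.sum_congr rfl fun RS _ => ?_
      split_ifs with hRS
      · rw [h5 _ hRS.1 _ hRS.2 T hT p hp q hq]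
      · rfl
  · intro hM
    have : M = ∑ R : ℛ, (M (h1 R R.2).choose.1 (h1 R R.2).choose.2) • adjMat R.1 := by
      ext u v
      rw [Matrix.sum_apply, Finset.sum_eq_single ⟨cls (u, v), (hcls _).1⟩]
      · simp only [Matrix.smul_apply, adjMat, (hcls (u, v)).2, if_true, smul_eq_mul, mul_one]
        exact hM _ (hcls (u, v)).1 (u, v) (hcls (u, v)).2 _ (h1 _ (hcls (u, v)).1).choose_spec
      · intro R _ hR
        have : (u, v) ∉ R.1 := fun h => hR (Subtype.ext (huniq _ _ ⟨R.2, h⟩))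
        simp [adjMat, this]
      · simp
    rw [this]
    exact Subalgebra.sum_mem _ fun R _ => Subalgebra.smul_mem _
      (Algebra.subset_adjoin (Set.mem_image_of_mem adjMat R.2)) _

theorem aux_basis {V : Type*} [Fintype V] [DecidableEq V] {ℛ : Set (Set (V × V))}
    (hCC : IsCC ℛ) : ∃ rep : ℛ → V × V, (∀ R, rep R ∈ R.1) ∧
      (∀ M ∈ adjAlg ℛ, M = ∑ R : ℛ, (M (rep R).1 (rep R).2) • adjMat R.1) ∧
      ∀ e f : adjAlg ℛ, LinearMap.trace ℂ (adjAlg ℛ)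
        (LinearMap.mulLeft ℂ e ∘ₗ LinearMap.mulRight ℂ f) =
        ∑ R : ℛ, (e.1 * (adjMat R.1 * f.1)) (rep R).1 (rep R).2 := by
  have hmem := aux_mem_adjAlg hCC
  obtain ⟨h1, h2, h3, h4, h5⟩ := hCC
  choose cls hcls huniq using h2
  simp only at hcls huniq
  let rep : ℛ → V × V := fun R => (h1 R R.2).choose
  have hrep : ∀ R, rep R ∈ R.1 := fun R => (h1 R R.2).choose_spec
  have hcr : ∀ R : ℛ, cls (rep R) = R.1 := fun R => (huniq _ _ ⟨R.2, hrep R⟩).symm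
  let L : adjAlg ℛ ≃ₗ[ℂ] (ℛ → ℂ) :=
    { toFun := fun a R => a.1 (rep R).1 (rep R).2
      map_add' := fun a b => rfl
      map_smul' := fun c a => rfl
      invFun := fun f => ⟨Matrix.of fun u v => f ⟨cls (u, v), (hcls _).1⟩, by
        rw [hmem]
        intro R hR p hp q hq
        have e1 := huniq p R ⟨hR, hp⟩
        have e2 := huniq q R ⟨hR, hq⟩
        rw [Matrix.of_apply, Matrix.of_apply]
        congr 2
        rw [Prod.mk.eta, Prod.mk.eta, ← e1, ← e2]⟩
      left_inv := by
        intro a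
        apply Subtype.ext
        ext u v
        exact (hmem a.1).mp a.2 _ (hcls (u, v)).1 _ (hrep ⟨cls (u, v), (hcls (u, v)).1⟩) (u, v) (hcls (u, v)).2
      right_inv := by
        intro f
        ext R
        simp only [Matrix.of_apply, Prod.mk.eta]
        congr 1
        exact Subtype.ext (hcr R) }
  let b := Module.Basis.ofEquivFun L
  have hb : ∀ R, (b R).1 = adjMat R.1 := by
    intro R
    ext u v
    simp only [b, Module.Basis.coe_ofEquivFun]
    change (Pi.single R (1:ℂ) : ℛ → ℂ) ⟨cls (u, v), (hcls _).1⟩ = _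
    rw [Pi.single_apply, adjMat]
    congr 1
    apply propext
    constructor
    · rintro rfl; exact (hcls _).2
    · intro h; exact Subtype.ext (huniq _ _ ⟨R.2, h⟩).symm
  refine ⟨rep, hrep, ?_, ?_⟩
  · intro M hM
    have := b.sum_equivFun ⟨M, hM⟩
    have := congrArg Subtype.val this
    rw [AddSubmonoidClass.coe_finsetSum] at this
    conv_lhs => rw [← show _ = M from this]
    refine Finset.sum_congr rfl fun R _ => ?_
    rw [← hb R]
    have : b.equivFun ⟨M, hM⟩ R = M (rep R).1 (rep R).2 := by
      simp only [b, Module.Basis.equivFun_ofEquivFun]; rfl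
    rw [this]
    rfl
  · intro e f
    rw [LinearMap.trace_eq_matrix_trace ℂ b, Matrix.trace]
    refine Finset.sum_congr rfl fun R _ => ?_
    rw [Matrix.diag, LinearMap.toMatrix_apply]
    rw [← hb R]
    rfl

theorem aux_idMat_mul {V : Type*} [Fintype V] (X : Set V) (M : Matrix V V ℂ) (u v : V) :
    (idMat X * M) u v = if u ∈ X then M u v else 0 := by
  rw [Matrix.mul_apply, Finset.sum_eq_single u]
  · simp [idMat]
  · intro b _ hb
    simp [idMat, hb.symm]
  · simp

theorem aux_mul_idMat {V : Type*} [Fintype V] (X : Set V) (M : Matrix V V ℂ) (u v : V) :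
    (M * idMat X) u v = if v ∈ X then M u v else 0 := by
  rw [Matrix.mul_apply, Finset.sum_eq_single v]
  · simp [idMat]
  · intro b _ hb
    simp [idMat, hb]
  · simp

theorem aux_idMat_eq {V : Type*} [Fintype V] (X : Set V) : idMat X = adjMat (diag X) := by
  ext u v
  simp only [idMat, adjMat, diag, Set.mem_ofPred_eq]
  congr 1
  apply propext; tauto

theorem aux_idMat_mem {V : Type*} [Fintype V] [DecidableEq V] {ℛ : Set (Set (V × V))}
    {X : Set V} (hX : IsFiber ℛ X) : idMat X ∈ adjAlg ℛ := by
  rw [aux_idMat_eq]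
  exact Algebra.subset_adjoin ⟨_, hX.2, rfl⟩

theorem aux_fib_inv {V : Type*} [Fintype V] [DecidableEq V] {ℛ : Set (Set (V × V))}
    (hCC : IsCC ℛ) {X : Set V} (hX : IsFiber ℛ X) {R : Set (V × V)} (hR : R ∈ ℛ)
    {p q : V × V} (hp : p ∈ R) (hq : q ∈ R) : (p.1 ∈ X ↔ q.1 ∈ X) ∧ (p.2 ∈ X ↔ q.2 ∈ X) := by
  have hJ : (Matrix.of fun _ _ => 1 : Matrix V V ℂ) ∈ adjAlg ℛ := by
    rw [aux_mem_adjAlg hCC]; intros; rfl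
  have hI := aux_idMat_mem hX
  have m1 := (aux_mem_adjAlg hCC _).mp (mul_mem hI hJ) R hR p hp q hq
  have m2 := (aux_mem_adjAlg hCC _).mp (mul_mem hJ hI) R hR p hp q hq
  rw [aux_idMat_mul, aux_idMat_mul] at m1
  rw [aux_mul_idMat, aux_mul_idMat] at m2
  constructor
  · by_cases a : p.1 ∈ X <;> by_cases b : q.1 ∈ X <;> simp [a, b] at m1 ⊢
  · by_cases a : p.2 ∈ X <;> by_cases b : q.2 ∈ X <;> simp [a, b] at m2 ⊢

theorem aux_relsBtw_iff {V : Type*} [Fintype V] [DecidableEq V] {ℛ : Set (Set (V × V))}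
    (hCC : IsCC ℛ) {X Y : Set V} (hX : IsFiber ℛ X) (hY : IsFiber ℛ Y) {R : Set (V × V)}
    (hR : R ∈ ℛ) {p : V × V} (hp : p ∈ R) : R ∈ relsBtw ℛ X Y ↔ p.1 ∈ X ∧ p.2 ∈ Y := by
  constructor
  · intro h; exact h.2 hp
  · rintro ⟨h1, h2⟩
    refine ⟨hR, fun q hq => ?_⟩
    exact ⟨(aux_fib_inv hCC hX hR hp hq).1.mp h1, (aux_fib_inv hCC hY hR hp hq).2.mp h2⟩

theorem aux_exists_fiber {V : Type*} [Fintype V] [DecidableEq V] {ℛ : Set (Set (V × V))}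
    (hCC : IsCC ℛ) (v : V) : ∃ X, IsFiber ℛ X ∧ v ∈ X ∧ ∀ Y, IsFiber ℛ Y → v ∈ Y → Y = X := by
  obtain ⟨h1, h2, h3, h4, h5⟩ := hCC
  obtain ⟨R, ⟨hR, hv⟩, hu⟩ := h2 (v, v)
  have e : diag {w | (w, w) ∈ R} = R := by
    ext ⟨a, b⟩
    simp only [diag, Set.mem_ofPred_eq]
    constructor
    · rintro ⟨h, rfl⟩; exact h
    · intro h
      have : a = b := h3 R hR ⟨_, hv, rfl⟩ _ h
      subst this; exact ⟨h, rfl⟩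
  refine ⟨{w | (w, w) ∈ R}, ⟨⟨v, hv⟩, by rw [e]; exact hR⟩, hv, ?_⟩
  intro Y hY hvY
  have : diag Y = R := hu _ ⟨hY.2, ⟨hvY, rfl⟩⟩
  ext w
  rw [Set.mem_ofPred_eq, ← this]
  simp [diag]

theorem aux_sum_idMat {V : Type*} [Fintype V] [DecidableEq V] {ℛ : Set (Set (V × V))}
    (hCC : IsCC ℛ) : (∑ X : {X : Set V // IsFiber ℛ X}, idMat X.1) = 1 := by
  ext u v
  rw [Matrix.sum_apply]
  by_cases h : u = v
  · subst h
    obtain ⟨X, hX, huX, hun⟩ := aux_exists_fiber hCC u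
    rw [Finset.sum_eq_single ⟨X, hX⟩]
    · simp [idMat, huX]
    · intro Y _ hY
      have : u ∉ Y.1 := fun h => hY (Subtype.ext (hun _ Y.2 h))
      simp [idMat, this]
    · simp
  · simp [idMat, h]

theorem aux_star {V : Type*} [Fintype V] [DecidableEq V] {ℛ : Set (Set (V × V))}
    (hCC : IsCC ℛ) : ∀ a ∈ adjAlg ℛ, Matrix.conjTranspose a ∈ adjAlg ℛ := by
  intro a ha
  rw [aux_mem_adjAlg hCC] at ha ⊢
  intro R hR p hp q hq
  simp only [Matrix.conjTranspose_apply]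
  rw [ha (transp R) (hCC.2.2.2.1 R hR) (p.2, p.1) hp (q.2, q.1) hq]

theorem aux_key1 {V : Type*} [Fintype V] [DecidableEq V] {ℛ : Set (Set (V × V))} {r : ℕ}
    (hCC : IsCC ℛ) (hbal : IsBalancedWith ℛ r) {X Y : Set V} (hX : IsFiber ℛ X)
    (hY : IsFiber ℛ Y) : LinearMap.trace ℂ (adjAlg ℛ)
        (LinearMap.mulLeft ℂ ⟨idMat X, aux_idMat_mem hX⟩ ∘ₗ
          LinearMap.mulRight ℂ ⟨idMat Y, aux_idMat_mem hY⟩) = r := by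
  obtain ⟨rep, hrep, _, htr⟩ := aux_basis hCC
  rw [htr]
  rw [← hbal X Y hX hY]
  have : ∀ R : ℛ, (idMat X * (adjMat R.1 * idMat Y)) (rep R).1 (rep R).2 =
      if R.1 ∈ relsBtw ℛ X Y then (1 : ℂ) else 0 := by
    intro R
    rw [aux_idMat_mul, aux_mul_idMat, aux_relsBtw_iff hCC hX hY R.2 (hrep R)]
    have : adjMat R.1 (rep R).1 (rep R).2 = 1 := by simp [adjMat, hrep R]
    rw [this]
    by_cases h1 : (rep R).1 ∈ X <;> by_cases h2 : (rep R).2 ∈ Y <;> simp [h1, h2]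
  rw [Finset.sum_congr rfl fun R _ => this R, Finset.sum_boole]
  congr 1
  rw [← Fintype.card_subtype, Nat.card_eq_fintype_card]
  apply Fintype.card_congr
  exact
    { toFun := fun R => ⟨R.1.1, R.2⟩
      invFun := fun R => ⟨⟨R.1, R.2.1⟩, R.2⟩
      left_inv := fun _ => rfl
      right_inv := fun _ => rfl }

theorem aux_comm {V : Type*} [Fintype V] [DecidableEq V] {ℛ : Set (Set (V × V))}
    (hCC : IsCC ℛ) {X : Set V} (hX : IsFiber ℛ X)
    (hcomm : ∀ R ∈ relsBtw ℛ X X, ∀ S ∈ relsBtw ℛ X X, ∀ T ∈ relsBtw ℛ X X,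
          sConst R S T = sConst S R T) (M N : Matrix V V ℂ) (hM : M ∈ adjAlg ℛ)
    (hN : N ∈ adjAlg ℛ) :
    idMat X * M * idMat X * N * idMat X = idMat X * N * idMat X * M * idMat X := by
  have hid : idMat X * idMat X = idMat X := by
    ext u v; rw [aux_idMat_mul]; simp only [idMat]; split_ifs <;> tauto
  obtain ⟨rep, hrep, hexp, _⟩ := aux_basis hCC
  have hIR : ∀ R : ℛ, idMat X * adjMat R.1 * idMat X =
      if R.1 ∈ relsBtw ℛ X X then adjMat R.1 else 0 := by
    intro R
    ext u v
    rw [aux_mul_idMat, aux_idMat_mul]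
    by_cases h : (u, v) ∈ R.1
    · rw [aux_relsBtw_iff hCC hX hX R.2 h]
      by_cases h1 : u ∈ X <;> by_cases h2 : v ∈ X <;> simp [h1, h2]
    · have : adjMat R.1 u v = 0 := by simp [adjMat, h]
      rw [this]
      split_ifs <;> simp [this]
  have hRS : ∀ R S, R ∈ relsBtw ℛ X X → S ∈ relsBtw ℛ X X →
      adjMat R * adjMat S = adjMat S * adjMat R := by
    have hprod : ∀ (R S : Set (V × V)) (u v : V), (adjMat R * adjMat S) u v = (iNum R S (u, v) : ℂ) := by
      intro R S u v
      rw [Matrix.mul_apply, iNum, Nat.card_eq_fintype_card, ← Set.toFinset_card,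
        Finset.cast_card]
      simp only [adjMat, mul_ite, mul_one, mul_zero, ← ite_and]
      rw [← Finset.sum_filter, Finset.sum_const, Finset.sum_const]
      congr 2
      ext w; simp [and_comm]
    intro R S hR hS
    ext u v
    rw [hprod, hprod]
    congr 1
    obtain ⟨T, ⟨hT, huv⟩, _⟩ := hCC.2.1 (u, v)
    by_cases hTX : T ∈ relsBtw ℛ X X
    · have := hcomm R hR S hS T hTX
      have hne : T.Nonempty := ⟨_, huv⟩
      simp only [sConst, dif_pos hne] at this
      rw [hCC.2.2.2.2 R hR.1 S hS.1 T hT (u, v) huv _ hne.choose_spec, this]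
      exact hCC.2.2.2.2 S hS.1 R hR.1 T hT _ hne.choose_spec (u, v) huv
    · rw [aux_relsBtw_iff hCC hX hX hT huv] at hTX
      have z : ∀ R S, R ∈ relsBtw ℛ X X → S ∈ relsBtw ℛ X X → iNum R S (u, v) = 0 := by
        intro R S hR hS
        have : {w : V | ((u, v).1, w) ∈ R ∧ (w, (u, v).2) ∈ S} = ∅ := by
          ext w
          simp only [Set.mem_ofPred_eq, Set.mem_empty_iff_false, iff_false]
          rintro ⟨a, b⟩
          exact hTX ⟨(hR.2 a).1, (hS.2 b).2⟩
        rw [iNum, this]; simp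
      rw [z R S hR hS, z S R hS hR]
  have hIRS : ∀ R S : ℛ, (idMat X * adjMat R.1 * idMat X) * (idMat X * adjMat S.1 * idMat X) =
      (idMat X * adjMat S.1 * idMat X) * (idMat X * adjMat R.1 * idMat X) := by
    intro R S
    rw [hIR, hIR]
    split_ifs with a b b
    · exact hRS _ _ a b
    all_goals simp
  have e1 : ∀ M N : Matrix V V ℂ, idMat X * M * idMat X * N * idMat X =
      (idMat X * M * idMat X) * (idMat X * N * idMat X) := by
    intro M N
    simp only [Matrix.mul_assoc]
    rw [← Matrix.mul_assoc (idMat X) (idMat X), hid]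
  rw [e1, e1]
  have step : ∀ (M) (_ : M ∈ adjAlg ℛ) (Q : Matrix V V ℂ),
      (∀ R : ℛ, Commute (idMat X * adjMat R.1 * idMat X) Q) → Commute (idMat X * M * idMat X) Q := by
    intro M hM Q hQ
    rw [hexp M hM]
    simp only [Finset.mul_sum, Finset.sum_mul, Matrix.mul_smul, Matrix.smul_mul]
    exact Commute.sum_left _ _ _ fun R _ => (hQ R).smul_left _
  exact step M hM _ fun R => (step N hN _ fun S => hIRS S R).symm

noncomputable def auxJ {V : Type*} [Fintype V] (X : Set V) : Matrix V V ℂ :=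
  Matrix.of fun u v => if u ∈ X ∧ v ∈ X then 1 else 0

theorem auxJ_apply {V : Type*} [Fintype V] (X : Set V) (u v : V) :
    auxJ X u v = if u ∈ X ∧ v ∈ X then 1 else 0 := rfl

theorem auxJ_mem {V : Type*} [Fintype V] [DecidableEq V] {ℛ : Set (Set (V × V))}
    (hCC : IsCC ℛ) {X : Set V} (hX : IsFiber ℛ X) : auxJ X ∈ adjAlg ℛ := by
  rw [aux_mem_adjAlg hCC]
  intro R hR p hp q hq
  obtain ⟨h1, h2⟩ := aux_fib_inv hCC hX hR hp hq
  simp only [auxJ_apply, h1, h2]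

theorem aux_deg {V : Type*} [Fintype V] [DecidableEq V] {ℛ : Set (Set (V × V))}
    (hCC : IsCC ℛ) {X : Set V} (hX : IsFiber ℛ X) :
    ∃ dg : ℛ → ℕ, (∀ R : ℛ, R.1 ∈ relsBtw ℛ X X → adjMat R.1 * auxJ X = (dg R : ℂ) • auxJ X) ∧
      (∀ R : ℛ, R.1 ∈ relsBtw ℛ X X → 0 < dg R) ∧
      (∀ R : ℛ, R.1 = diag X → dg R = 1) ∧
      (∑ R : ℛ, (if R.1 ∈ relsBtw ℛ X X then dg R else 0)) =
        (Finset.univ.filter (fun u => u ∈ X)).card := by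
  obtain ⟨u0, hu0⟩ := hX.1
  have hones : (Matrix.of fun _ _ => 1 : Matrix V V ℂ) ∈ adjAlg ℛ := by
    rw [aux_mem_adjAlg hCC]; intros; rfl
  have hdeg : ∀ (R : Set (V × V)) (u : V), (adjMat R * (Matrix.of fun _ _ => 1 : Matrix V V ℂ)) u u =
      ((Finset.univ.filter (fun w => (u, w) ∈ R)).card : ℂ) := by
    intro R u
    rw [Matrix.mul_apply]
    simp [adjMat]
  have hconst : ∀ R ∈ ℛ, ∀ u ∈ X, (Finset.univ.filter (fun w => (u, w) ∈ R)).card =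
      (Finset.univ.filter (fun w => (u0, w) ∈ R)).card := by
    intro R hR u hu
    have hAR : adjMat R ∈ adjAlg ℛ := Algebra.subset_adjoin (Set.mem_image_of_mem adjMat hR)
    have := (aux_mem_adjAlg hCC _).mp (mul_mem hAR hones) _ hX.2 (u, u) ⟨hu, rfl⟩ (u0, u0) ⟨hu0, rfl⟩
    simp only [hdeg] at this
    exact_mod_cast this
  refine ⟨fun R => (Finset.univ.filter (fun w => (u0, w) ∈ R.1)).card, ?_, ?_, ?_, ?_⟩
  · intro R hR
    ext u v
    rw [Matrix.smul_apply, auxJ_apply, Matrix.mul_apply]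
    by_cases hu : u ∈ X
    · beta_reduce
      rw [← hconst R.1 R.2 u hu]
      by_cases hv : v ∈ X
      · simp only [auxJ_apply, hu, hv, and_true, if_true, smul_eq_mul, mul_one]
        rw [Finset.card_filter]
        push_cast
        refine Finset.sum_congr rfl fun w _ => ?_
        by_cases hw : (u, w) ∈ R.1
        · have := (hR.2 hw).2
          simp only at this
          simp [adjMat, hw, this]
        · simp [adjMat, hw]
      · simp [auxJ_apply, hv]
    · simp only [hu, false_and, if_false, smul_zero]
      refine Finset.sum_eq_zero fun w _ => ?_
      have : (u, w) ∉ R.1 := fun h => hu (hR.2 h).1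
      simp [adjMat, this]
  · intro R hR
    obtain ⟨p, hp⟩ := hCC.1 R.1 R.2
    beta_reduce
    rw [← hconst R.1 R.2 p.1 (hR.2 hp).1]
    exact Finset.card_pos.mpr ⟨p.2, by simpa using hp⟩
  · intro R hR
    rw [Finset.card_eq_one]
    refine ⟨u0, ?_⟩
    ext w
    simp only [hR, diag, Finset.mem_filter, Finset.mem_univ, true_and, Set.mem_ofPred_eq, Finset.mem_singleton]
    exact ⟨fun h => h.2.symm, fun h => ⟨hu0, h.symm⟩⟩
  · simp only [Finset.card_filter]
    have : ∀ R : ℛ, (if R.1 ∈ relsBtw ℛ X X then (∑ w, if (u0, w) ∈ R.1 then 1 else 0) else 0) =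
        ∑ w, if (u0, w) ∈ R.1 ∧ w ∈ X then 1 else 0 := by
      intro R
      split_ifs with h
      · refine Finset.sum_congr rfl fun w _ => ?_
        by_cases hw : (u0, w) ∈ R.1
        · have := (h.2 hw).2
          simp only at this
          simp [hw, this]
        · simp [hw]
      · symm
        refine Finset.sum_eq_zero fun w _ => ?_
        rw [if_neg]
        rintro ⟨h1, h2⟩
        exact h ((aux_relsBtw_iff hCC hX hX R.2 h1).mpr ⟨hu0, h2⟩)
    rw [Finset.sum_congr rfl fun R _ => this R, Finset.sum_comm]
    refine Finset.sum_congr rfl fun w _ => ?_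
    obtain ⟨R, ⟨hR, hw⟩, hun⟩ := hCC.2.1 (u0, w)
    rw [Finset.sum_eq_single ⟨R, hR⟩]
    · simp [hw]
    · intro S _ hS
      rw [if_neg]
      rintro ⟨h1, _⟩
      exact hS (Subtype.ext (hun _ ⟨S.2, h1⟩))
    · simp

theorem aux_key2 {V : Type*} [Fintype V] [DecidableEq V] {ℛ : Set (Set (V × V))}
    (hCC : IsCC ℛ) {X : Set V} (hX : IsFiber ℛ X) (e : adjAlg ℛ)
    (he : e.1 = ((Finset.univ.filter (fun u => u ∈ X)).card : ℂ)⁻¹ • auxJ X) :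
    LinearMap.trace ℂ (adjAlg ℛ)
        (LinearMap.mulLeft ℂ ⟨idMat X, aux_idMat_mem hX⟩ ∘ₗ LinearMap.mulRight ℂ e) = 1 := by
  obtain ⟨rep, hrep, _, htr⟩ := aux_basis hCC
  obtain ⟨dg, hd1, hd2, hd3, hd4⟩ := aux_deg hCC hX
  rw [htr]
  have hN : ((Finset.univ.filter (fun u => u ∈ X)).card : ℂ) ≠ 0 := by
    obtain ⟨u, hu⟩ := hX.1
    have : 0 < (Finset.univ.filter (fun u => u ∈ X)).card := Finset.card_pos.mpr ⟨u, by simpa using hu⟩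
    exact_mod_cast this.ne'
  have : ∀ R : ℛ, (idMat X * (adjMat R.1 * e.1)) (rep R).1 (rep R).2 =
      ((Finset.univ.filter (fun u => u ∈ X)).card : ℂ)⁻¹ *
        ((if R.1 ∈ relsBtw ℛ X X then dg R else 0 : ℕ) : ℂ) := by
    intro R
    rw [aux_idMat_mul, he, Matrix.mul_smul]
    by_cases hR : R.1 ∈ relsBtw ℛ X X
    · rw [if_pos hR, hd1 R hR]
      have := (aux_relsBtw_iff hCC hX hX R.2 (hrep R)).mp hR
      simp [auxJ_apply, this]
    · rw [if_neg hR]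
      rw [aux_relsBtw_iff hCC hX hX R.2 (hrep R)] at hR
      split_ifs with h
      · have h2 : (rep R).2 ∉ X := fun h2 => hR ⟨h, h2⟩
        rw [Matrix.smul_apply, Matrix.mul_apply]
        simp [auxJ_apply, h2]
      · simp
  rw [Finset.sum_congr rfl fun R _ => this R, ← Finset.mul_sum, ← Nat.cast_sum, hd4]
  exact inv_mul_cancel₀ hN

theorem aux_int_arith (χ m : ℂ) (t g N : ℕ) (hχ : IsIntegral ℤ χ) (h1 : m * t = N) (h2 : m * χ = -g)
    (ht : 0 < t) (hg : 0 < g) (hN : 0 < N) : N ≤ t * g := by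
  have hNc : (N : ℂ) ≠ 0 := by exact_mod_cast hN.ne'
  have e : (N : ℂ) * χ = -(t * g : ℂ) := by
    rw [← h1]; linear_combination (t : ℂ) * h2
  have hq : χ = algebraMap ℚ ℂ (-(t * g : ℚ) / N) := by
    simp only [map_div₀, map_neg, map_mul, map_natCast]
    rw [eq_div_iff hNc]; linear_combination e
  rw [hq, isIntegral_algebraMap_iff (algebraMap ℚ ℂ).injective] at hχ
  obtain ⟨z, hz⟩ := IsIntegrallyClosed.isIntegral_iff.mp hχ
  have hNq : (N : ℚ) ≠ 0 := by exact_mod_cast hN.ne'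
  rw [eq_div_iff hNq] at hz
  have hz' : z * N = -(t * g : ℤ) := by
    have : ((z : ℚ)) * N = -(t * g : ℚ) := by simpa using hz
    exact_mod_cast this
  have hd : (N : ℤ) ∣ (t * g : ℕ) := ⟨-z, by push_cast; linarith⟩
  exact Nat.le_of_dvd (Nat.mul_pos ht hg) (by exact_mod_cast hd)

theorem aux_adjMat_integral {V : Type*} [Fintype V] [DecidableEq V] (R : Set (V × V)) :
    IsIntegral ℤ (adjMat R) := by
  have h := Matrix.isIntegral (R := ℤ) (Matrix.of fun u v => if (u, v) ∈ R then 1 else 0 : Matrix V V ℤ)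
  have h2 := h.map (RingHom.toIntAlgHom ((Int.castRingHom ℂ).mapMatrix (m := V)))
  convert h2 using 1
  ext u v
  simp [adjMat]

theorem aux_trace_transfer {V : Type*} [Fintype V] [DecidableEq V]
    (A : Subalgebra ℂ (Matrix V V ℂ)) {n : ℕ} {d : Fin n → ℕ}
    (φ : A ≃ₐ[ℂ] (∀ i, Matrix (Fin (d i)) (Fin (d i)) ℂ)) (e f : A) :
    LinearMap.trace ℂ A (LinearMap.mulLeft ℂ e ∘ₗ LinearMap.mulRight ℂ f) =
      ∑ i, (φ e i).trace * (φ f i).trace := by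
  rw [← LinearMap.trace_conj' _ φ.toLinearEquiv, ← aux_trace_pi]
  congr 1
  refine LinearMap.ext fun a => ?_
  simp [LinearEquiv.conj_apply]

theorem aux_idMat_idem {V : Type*} [Fintype V] (X : Set V) : idMat X * idMat X = idMat X := by
  ext u v; rw [aux_idMat_mul]; simp only [idMat]; split_ifs <;> tauto

theorem auxJ_sq {V : Type*} [Fintype V] (X : Set V) :
    auxJ X * auxJ X = ((Finset.univ.filter (fun u => u ∈ X)).card : ℂ) • auxJ X := by
  ext u v
  rw [Matrix.mul_apply, Matrix.smul_apply]
  simp only [auxJ_apply]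
  by_cases hu : u ∈ X <;> by_cases hv : v ∈ X <;> simp [hu, hv]
  rw [Finset.card_filter]
  push_cast
  exact Finset.sum_congr rfl fun x _ => by split_ifs <;> rfl

theorem aux_card_B {V : Type*} [Fintype V] {ℛ : Set (Set (V × V))} {r : ℕ}
    (hbal : IsBalancedWith ℛ r) {X : Set V} (hX : IsFiber ℛ X) :
    (Finset.univ.filter (fun R : ℛ => R.1 ∈ relsBtw ℛ X X)).card = r := by
  rw [← hbal X X hX hX, ← Fintype.card_subtype, Nat.card_eq_fintype_card]
  apply Fintype.card_congr
  exact
    { toFun := fun R => ⟨R.1.1, R.2⟩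
      invFun := fun R => ⟨⟨R.1, R.2.1⟩, R.2⟩
      left_inv := fun _ => rfl
      right_inv := fun _ => rfl }

/-- **Theorem (Statement 6).** Let `𝒞` be `r`-balanced. If some homogeneous component
`𝒞_X` is commutative then `|𝒫(𝒞)| = r`; in particular `|𝒫(𝒞)| = r` whenever `r ≤ 5`. -/
theorem r_balanced_card_CPIs
    {V : Type*} [Fintype V] [DecidableEq V] [Nonempty V]
    (ℛ : Set (Set (V × V))) (r : ℕ) (hCC : IsCC ℛ) (hbal : IsBalancedWith ℛ r) :
    ((∃ X : Set V, IsFiber ℛ X ∧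
        ∀ R ∈ relsBtw ℛ X X, ∀ S ∈ relsBtw ℛ X X, ∀ T ∈ relsBtw ℛ X X,
          sConst R S T = sConst S R T) →
      Nat.card (CPIs ℛ) = r) ∧
    (r ≤ 5 → Nat.card (CPIs ℛ) = r) := by
  obtain ⟨X0, hX0, -, -⟩ := aux_exists_fiber hCC (Classical.arbitrary V)
  have hss : IsSemisimpleRing (adjAlg ℛ) := aux_semisimple _ (aux_star hCC)
  obtain ⟨n, d, hd, ⟨φ⟩⟩ :=
    IsSemisimpleRing.exists_algEquiv_pi_matrix_of_isAlgClosed ℂ (adjAlg ℛ)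
  have hcard : Nat.card (CPIs ℛ) = n := aux_cpi_card (adjAlg ℛ) φ
  rw [hcard]
  have hT := aux_trace_transfer (adjAlg ℛ) φ
  let iX : {X : Set V // IsFiber ℛ X} → adjAlg ℛ := fun X => ⟨idMat X.1, aux_idMat_mem X.2⟩
  have hidem : ∀ X, iX X * iX X = iX X := fun X => Subtype.ext (aux_idMat_idem X.1)
  have hidemφ : ∀ X i, φ (iX X) i * φ (iX X) i = φ (iX X) i := by
    intro X i
    rw [← Pi.mul_apply, ← map_mul, hidem]
  choose t ht ht0 using fun X i => aux_idem_trace _ (hidemφ X i)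
  have hkey : ∀ X Y, ∑ i, t X i * t Y i = r := by
    intro X Y
    have h1 := aux_key1 hCC hbal X.2 Y.2
    have h2 := hT (iX X) (iX Y)
    have h3 := h2.symm.trans h1
    simp only [ht] at h3
    exact_mod_cast h3
  have hconst : ∀ X Y i, t X i = t Y i := by
    intro X Y i
    have h0 : ∑ i, ((t X i : ℤ) - t Y i) ^ 2 = 0 := by
      have a := hkey X X
      have b := hkey X Y
      have c := hkey Y Y
      zify at a b c
      have : ∑ i, ((t X i : ℤ) - t Y i) ^ 2 = ∑ i, (t X i : ℤ) * t X i - 2 * ∑ i, (t X i : ℤ) * t Y i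
          + ∑ i, (t Y i : ℤ) * t Y i := by
        rw [Finset.mul_sum, ← Finset.sum_sub_distrib, ← Finset.sum_add_distrib]
        exact Finset.sum_congr rfl fun i _ => by ring
      rw [this, a, b, c]; ring
    have h1 := (Finset.sum_eq_zero_iff_of_nonneg (fun i _ => sq_nonneg _)).mp h0 i (Finset.mem_univ _)
    have h2 : (t X i : ℤ) - t Y i = 0 := by simpa using h1
    have : (t X i : ℤ) = t Y i := by linarith
    exact_mod_cast this
  have hsum1 : ∑ X, iX X = 1 := by
    apply Subtype.ext
    rw [AddSubmonoidClass.coe_finsetSum]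
    exact aux_sum_idMat hCC
  have hpos : ∀ X i, 0 < t X i := by
    intro X i
    rw [Nat.pos_iff_ne_zero]
    intro h0
    have hz : ∀ Y, φ (iX Y) i = 0 := fun Y => ht0 Y i (by rw [hconst Y X, h0])
    have h1 : φ (∑ X, iX X) i = 0 := by
      rw [map_sum, Finset.sum_apply]
      exact Finset.sum_eq_zero fun Y _ => hz Y
    rw [hsum1, map_one, Pi.one_apply] at h1
    exact one_ne_zero h1
  have hfin : ∀ X, (∀ i, t X i = 1) → n = r := by
    intro X h
    have := hkey X X
    simpa [h] using this
  refine ⟨?_, ?_⟩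
  · rintro ⟨X, hX, hcomm⟩
    apply hfin ⟨X, hX⟩
    intro i
    have h3 := aux_comm_trace (φ (iX ⟨X, hX⟩) i) (hidemφ _ _) (by
      intro M N
      have hc : iX ⟨X, hX⟩ * φ.symm (Pi.single i M) * iX ⟨X, hX⟩ * φ.symm (Pi.single i N) * iX ⟨X, hX⟩
        = iX ⟨X, hX⟩ * φ.symm (Pi.single i N) * iX ⟨X, hX⟩ * φ.symm (Pi.single i M) * iX ⟨X, hX⟩ :=
        Subtype.ext (aux_comm hCC hX hcomm _ _ (φ.symm (Pi.single i M)).2 (φ.symm (Pi.single i N)).2)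
      have := congrFun (congrArg φ hc) i
      simpa only [map_mul, Pi.mul_apply, AlgEquiv.apply_symm_apply, Pi.single_eq_same] using this)
    rw [ht] at h3
    have h4 : t ⟨X, hX⟩ i ^ 3 = t ⟨X, hX⟩ i := by exact_mod_cast h3
    have h5 := hpos ⟨X, hX⟩ i
    have h6 : t ⟨X, hX⟩ i * t ⟨X, hX⟩ i = 1 := by
      apply Nat.eq_of_mul_eq_mul_left h5
      linarith [h4, pow_three (t ⟨X, hX⟩ i)]
    exact Nat.eq_one_of_mul_eq_one_left h6
  · intro hr
    by_contra hne
    let X : {X : Set V // IsFiber ℛ X} := ⟨X0, hX0⟩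
    have hnall : ¬ ∀ i, t X i = 1 := fun h => hne (hfin X h)
    push Not at hnall
    obtain ⟨i1, hi1⟩ := hnall
    have hi1' : 2 ≤ t X i1 := by have := hpos X i1; omega
    obtain ⟨N, hN⟩ : ∃ N, N = (Finset.univ.filter (fun u => u ∈ X0)).card := ⟨_, rfl⟩
    have hN0 : (N : ℂ) ≠ 0 := by
      obtain ⟨u, hu⟩ := hX0.1
      have : 0 < N := by rw [hN]; exact Finset.card_pos.mpr ⟨u, by simpa using hu⟩
      exact_mod_cast this.ne'
    let e : adjAlg ℛ := ⟨(N : ℂ)⁻¹ • auxJ X0, Subalgebra.smul_mem _ (auxJ_mem hCC hX0) _⟩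
    have hee : e * e = e := by
      apply Subtype.ext
      change ((N : ℂ)⁻¹ • auxJ X0) * ((N : ℂ)⁻¹ • auxJ X0) = (N : ℂ)⁻¹ • auxJ X0
      rw [Matrix.smul_mul, Matrix.mul_smul, auxJ_sq, ← hN, smul_smul (N : ℂ)⁻¹ (N : ℂ), inv_mul_cancel₀ hN0, one_smul]
    have hIe : iX X * e = e := by
      apply Subtype.ext
      change idMat X0 * ((N : ℂ)⁻¹ • auxJ X0) = (N : ℂ)⁻¹ • auxJ X0
      ext u v
      rw [aux_idMat_mul, Matrix.smul_apply, auxJ_apply]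
      by_cases h : u ∈ X0 <;> simp [h]
    have heI : e * iX X = e := by
      apply Subtype.ext
      change ((N : ℂ)⁻¹ • auxJ X0) * idMat X0 = (N : ℂ)⁻¹ • auxJ X0
      ext u v
      rw [aux_mul_idMat, Matrix.smul_apply, auxJ_apply]
      by_cases h : v ∈ X0 <;> simp [h]
    have heφ : ∀ i, φ e i * φ e i = φ e i := by
      intro i
      rw [← Pi.mul_apply, ← map_mul, hee]
    choose s hs hs0 using fun i => aux_idem_trace _ (heφ i)
    have hts : ∑ i, t X i * s i = 1 := by
      have h1 := aux_key2 hCC hX0 e (by rw [← hN])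
      have h2 := hT (iX X) e
      have h3 := h2.symm.trans h1
      simp only [ht, hs] at h3
      exact_mod_cast h3
    obtain ⟨i0, hi0⟩ : ∃ i0, t X i0 * s i0 ≠ 0 := by
      by_contra! h
      simp [h] at hts
    have hsplit := Finset.add_sum_erase Finset.univ (fun i => t X i * s i) (Finset.mem_univ i0)
    rw [hts] at hsplit
    have hi0' : t X i0 * s i0 = 1 := by omega
    have ht1 : t X i0 = 1 := Nat.eq_one_of_mul_eq_one_right hi0'
    have hs1 : s i0 = 1 := Nat.eq_one_of_mul_eq_one_left hi0'
    have hoff : ∀ j, j ≠ i0 → s j = 0 := by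
      intro j hj
      have h0 : ∑ i ∈ Finset.univ.erase i0, t X i * s i = 0 := by omega
      have := (Finset.sum_eq_zero_iff.mp h0) j (by simp [hj])
      rcases Nat.mul_eq_zero.mp this with h | h
      · have := hpos X j; omega
      · exact h
    have hne01 : i1 ≠ i0 := by rintro rfl; omega
    have hsq := hkey X X
    rw [← Finset.add_sum_erase Finset.univ _ (Finset.mem_univ i0),
      ← Finset.add_sum_erase (Finset.univ.erase i0) _ (Finset.mem_erase.mpr ⟨hne01, Finset.mem_univ i1⟩),
      ht1] at hsq
    have ht2 : t X i1 = 2 := by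
      by_contra h
      have : 3 ≤ t X i1 := by omega
      have h9 := Nat.mul_le_mul this this
      omega
    rw [ht2] at hsq
    have hr5 : r = 5 := by omega
    have hrest : ∑ i ∈ (Finset.univ.erase i0).erase i1, t X i * t X i = 0 := by omega
    have honly : ∀ i, i = i0 ∨ i = i1 := by
      intro i
      by_contra! h
      have := (Finset.sum_eq_zero_iff.mp hrest) i (by simp [h.1, h.2])
      have h2 := hpos X i
      have := mul_self_eq_zero.mp this
      omega
    have hφe1 : φ e i1 = 0 := hs0 i1 (hoff i1 hne01)
    have hφz0 : φ (iX X - e) i0 = 0 := by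
      have hzz : (iX X - e) * (iX X - e) = iX X - e := by
        rw [sub_mul, mul_sub, mul_sub, hidem, hIe, heI, hee]; simp
      obtain ⟨k, hk, hk0⟩ := aux_idem_trace (φ (iX X - e) i0) (by
        rw [← Pi.mul_apply, ← map_mul, hzz])
      apply hk0
      rw [map_sub, Pi.sub_apply, Matrix.trace_sub, ht, hs, ht1, hs1, sub_self] at hk
      exact_mod_cast hk.symm
    obtain ⟨m, hm⟩ := aux_functional ((Matrix.traceLinearMap V ℂ ℂ) ∘ₗ (adjAlg ℛ).val.toLinearMap ∘ₗ
      φ.symm.toLinearMap) (by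
        intro a b
        change ((φ.symm (a * b)).1).trace = ((φ.symm (b * a)).1).trace
        rw [map_mul, map_mul]
        exact Matrix.trace_mul_comm _ _)
    have hm' : ∀ a : adjAlg ℛ, φ a i0 = 0 → a.1.trace = m i1 * (φ a i1).trace := by
      intro a ha
      have := hm (φ a)
      rw [Finset.sum_eq_single i1] at this
      · simpa using this
      · intro j _ hj
        have : j = i0 := (honly j).resolve_right hj
        subst this
        rw [ha]; simp
      · simp
    have htre : e.1.trace = 1 := by
      change ((N : ℂ)⁻¹ • auxJ X0).trace = 1
      rw [Matrix.trace_smul, Matrix.trace]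
      simp only [Matrix.diag, auxJ_apply, and_self, Finset.sum_boole, ← hN]
      exact inv_mul_cancel₀ hN0
    have htrI : (iX X).1.trace = N := by
      change (idMat X0).trace = N
      rw [Matrix.trace]
      simp [idMat, hN]
    have hm1 : m i1 * (2 : ℕ) = (N : ℂ) - 1 := by
      have := hm' _ hφz0
      rw [map_sub, Pi.sub_apply, hφe1, sub_zero, ht, ht2] at this
      rw [← this]
      change ((iX X).1 - e.1).trace = _
      rw [Matrix.trace_sub, htre, htrI]
    obtain ⟨dg, hd1, hd2, hd3, hd4⟩ := aux_deg hCC hX0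
    have hcB := aux_card_B hbal hX0
    rw [← hN, ← Finset.sum_filter] at hd4
    obtain ⟨B, hB⟩ : ∃ B : Finset ℛ, B = Finset.univ.filter (fun R : ℛ => R.1 ∈ relsBtw ℛ X0 X0) := ⟨_, rfl⟩
    rw [← hB] at hd4 hcB
    let D : ℛ := ⟨diag X0, hX0.2⟩
    have hDB : D ∈ B := by
      rw [hB, Finset.mem_filter]
      refine ⟨Finset.mem_univ _, hX0.2, ?_⟩
      rintro ⟨a, b⟩ ⟨h1, h2⟩
      simp only at h1 h2
      subst h2
      exact ⟨h1, h1⟩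
    have hF : (B.erase D).card = 4 := by rw [Finset.card_erase_of_mem hDB, hcB, hr5]
    rw [← Finset.add_sum_erase B dg hDB, hd3 D rfl] at hd4
    obtain ⟨K, hK⟩ : ∃ K, K = ∑ R ∈ B.erase D, dg R := ⟨_, rfl⟩
    rw [← hK] at hd4
    have hKc : (N : ℂ) - 1 = K := by rw [← hd4]; push_cast; ring
    rw [hKc] at hm1
    have hBmem : ∀ R ∈ B.erase D, R.1 ∈ relsBtw ℛ X0 X0 := by
      intro R hR
      have := Finset.mem_of_mem_erase hR
      rw [hB] at this
      exact (Finset.mem_filter.mp this).2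
    have hKpos : 0 < K := by
      rw [hK]
      apply Finset.sum_pos
      · intro R hR; exact hd2 R (hBmem R hR)
      · apply Finset.card_pos.mp; omega
    have hle : ∀ R ∈ B.erase D, K ≤ 2 * dg R := by
      intro R hR
      have hRX := hBmem R hR
      let a : adjAlg ℛ := ⟨adjMat R.1, Algebra.subset_adjoin (Set.mem_image_of_mem adjMat R.2)⟩
      have haI : a * iX X = a := by
        apply Subtype.ext
        change adjMat R.1 * idMat X0 = adjMat R.1
        ext u v
        rw [aux_mul_idMat]
        split_ifs with h
        · rfl
        · have : (u, v) ∉ R.1 := fun h' => h (hRX.2 h').2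
          simp [adjMat, this]
      have hae : (a * e).1 = (dg R : ℂ) • e.1 := by
        change adjMat R.1 * ((N : ℂ)⁻¹ • auxJ X0) = (dg R : ℂ) • ((N : ℂ)⁻¹ • auxJ X0)
        rw [Matrix.mul_smul, hd1 R hRX, smul_comm]
      have htra : a.1.trace = 0 := by
        change (adjMat R.1).trace = 0
        rw [Matrix.trace]
        refine Finset.sum_eq_zero fun u _ => ?_
        have : (u, u) ∉ R.1 := by
          intro h
          have huX := (hRX.2 h).1
          have hRD : R.1 = diag X0 :=
            (hCC.2.1 (u, u)).unique ⟨R.2, h⟩ ⟨hX0.2, ⟨huX, rfl⟩⟩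
          exact (Finset.ne_of_mem_erase hR) (Subtype.ext hRD)
        simp [Matrix.diag, adjMat, this]
      have h1 := hm' (a * (iX X - e)) (by rw [map_mul, Pi.mul_apply, hφz0, mul_zero])
      have h2 : (a * (iX X - e)).1.trace = -(dg R : ℂ) := by
        rw [mul_sub, haI]
        change (a.1 - (a * e).1).trace = _
        rw [Matrix.trace_sub, hae, Matrix.trace_smul, htra, htre]; simp
      rw [h2, mul_sub, haI, map_sub, Pi.sub_apply, map_mul, Pi.mul_apply, hφe1, mul_zero, sub_zero] at h1
      refine aux_int_arith _ (m i1) 2 (dg R) K ?_ hm1 h1.symm (by norm_num) (hd2 R hRX) hKpos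
      apply aux_integral_trace
      have hia : IsIntegral ℤ a := by
        have := aux_adjMat_integral R.1
        exact (isIntegral_algHom_iff ((adjAlg ℛ).val.restrictScalars ℤ) Subtype.val_injective).mp this
      have := hia.map ((Pi.evalAlgHom ℂ (fun i => Matrix (Fin (d i)) (Fin (d i)) ℂ) i1).comp
        φ.toAlgHom |>.restrictScalars ℤ)
      exact this
    have := Finset.sum_le_sum hle
    rw [Finset.sum_const, hF, ← Finset.mul_sum, ← hK, smul_eq_mul] at this
    omega

end CCPaper
end

section
/- If 𝒞 = (V,ℛ) is a balanced coherent configuration, then 𝒞 is half-homogeneous: all fibers of 𝒞 have the same size, namely |X| = |V|/|Fib(𝒞)| for every fiber X. -/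
open scoped Classical

namespace CCPaper

variable {V : Type*}

section Core
open Matrix

/-- The averaging operator. -/
noncomputable def avg {V ι : Type*} [Fintype V] [Fintype ι]
    (A : ι → Matrix V V ℝ) (N : ι → ℝ) (x : Matrix V V ℝ) : Matrix V V ℝ :=
  ∑ i, (N i)⁻¹ • ((A i)ᵀ * x * A i)

lemma avg_comm {V ι : Type*} [Fintype V] [Fintype ι]
    (A : ι → Matrix V V ℝ) (N : ι → ℝ)
    (τ : ι → ι) (hτ : ∀ i, A (τ i) = (A i)ᵀ)
    (H1 : ∀ i j, A i * A j = ∑ k, (trace (A i * A j * (A k)ᵀ) * (N k)⁻¹) • A k)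
    (x : Matrix V V ℝ) (j : ι) : A j * avg A N x = avg A N x * A j := by
  have H2 : ∀ k, A j * (A k)ᵀ = ∑ i, (trace (A i * A j * (A k)ᵀ) * (N i)⁻¹) • (A i)ᵀ := by
    intro k
    have h := congrArg transpose (H1 k (τ j))
    rw [hτ, transpose_mul, transpose_transpose, transpose_sum] at h
    rw [h]
    refine Finset.sum_congr rfl fun i _ => ?_
    rw [transpose_smul, ← trace_transpose (A k * (A j)ᵀ * (A i)ᵀ)]
    simp [transpose_mul, Matrix.mul_assoc]
  have e1 : A j * avg A N x = ∑ k, ∑ i, ((N k)⁻¹ * (trace (A i * A j * (A k)ᵀ) * (N i)⁻¹)) •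
      ((A i)ᵀ * x * A k) := by
    rw [avg, Finset.mul_sum]
    refine Finset.sum_congr rfl fun k _ => ?_
    rw [mul_smul_comm, ← Matrix.mul_assoc, ← Matrix.mul_assoc, H2 k, Finset.sum_mul,
      Finset.sum_mul, Finset.smul_sum]
    refine Finset.sum_congr rfl fun i _ => ?_
    rw [smul_mul_assoc, smul_mul_assoc, smul_smul]
  have e2 : avg A N x * A j = ∑ i, ∑ k, ((N k)⁻¹ * (trace (A i * A j * (A k)ᵀ) * (N i)⁻¹)) •
      ((A i)ᵀ * x * A k) := by
    rw [avg, Finset.sum_mul]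
    refine Finset.sum_congr rfl fun i _ => ?_
    rw [smul_mul_assoc, Matrix.mul_assoc]
    conv_lhs => rw [H1 i j]
    rw [Finset.mul_sum, Finset.smul_sum]
    refine Finset.sum_congr rfl fun k _ => ?_
    rw [mul_smul_comm, smul_smul]
    congr 1
    ring
  rw [e1, e2, Finset.sum_comm]

lemma avg_adj {V ι : Type*} [Fintype V] [Fintype ι]
    (A : ι → Matrix V V ℝ) (N : ι → ℝ)
    (τ : ι ≃ ι) (hτ : ∀ i, A (τ i) = (A i)ᵀ) (hN : ∀ i, N (τ i) = N i)
    (x y : Matrix V V ℝ) : trace (avg A N x * y) = trace (x * avg A N y) := by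
  have : avg A N y = ∑ i, (N i)⁻¹ • (A i * y * (A i)ᵀ) := by
    rw [avg, ← Equiv.sum_comp τ]
    refine Finset.sum_congr rfl fun i _ => ?_
    rw [hτ, hN, transpose_transpose]
  rw [this, avg, Finset.sum_mul, Finset.mul_sum, trace_sum, trace_sum]
  refine Finset.sum_congr rfl fun i _ => ?_
  rw [smul_mul_assoc, mul_smul_comm, trace_smul, trace_smul]
  congr 1
  rw [Matrix.mul_assoc, Matrix.mul_assoc, trace_mul_comm]
  simp only [Matrix.mul_assoc]

lemma core {V ι : Type*} [Fintype V] [DecidableEq V] [Fintype ι]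
    (A : ι → Matrix V V ℝ) (N : ι → ℝ) (hpos : ∀ i, 0 < N i)
    (τ : ι ≃ ι) (hτ : ∀ i, A (τ i) = (A i)ᵀ) (hN : ∀ i, N (τ i) = N i)
    (H1 : ∀ i j, A i * A j = ∑ k, (trace (A i * A j * (A k)ᵀ) * (N k)⁻¹) • A k)
    (hinj : ∀ x : Matrix V V ℝ, (∀ i, A i * x = 0) → x = 0)
    (d : Matrix V V ℝ) (hd : dᵀ = d) (h0 : trace (avg A N d * d) = 0) : trace d = 0 := by
  have hcomm := avg_comm A N τ hτ H1
  have hadj := avg_adj A N τ hτ hN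
  have hcen : ∀ z, (∀ j, A j * z = z * A j) → avg A N z = avg A N 1 * z := by
    intro z hz
    simp only [avg]
    rw [Finset.sum_mul]
    refine Finset.sum_congr rfl fun i _ => ?_
    rw [smul_mul_assoc, Matrix.mul_one, Matrix.mul_assoc, Matrix.mul_assoc, hz]
  have hcen' : ∀ z, (∀ j, A j * z = z * A j) → avg A N z = z * avg A N 1 := by
    intro z hz
    simp only [avg]
    rw [Finset.mul_sum]
    refine Finset.sum_congr rfl fun i _ => ?_
    rw [mul_smul_comm, Matrix.mul_one, ← Matrix.mul_assoc, ← hτ, hz]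
  have hsymm : ∀ x : Matrix V V ℝ, xᵀ = x → (avg A N x)ᵀ = avg A N x := by
    intro x hx
    rw [avg, transpose_sum]
    refine Finset.sum_congr rfl fun i _ => ?_
    rw [transpose_smul, transpose_mul, transpose_mul, hx, transpose_transpose, Matrix.mul_assoc]
  set c := avg A N 1 with hc
  set s := avg A N d with hs
  -- definiteness
  have hquad : ∀ t : Matrix V V ℝ, trace (tᵀ * c * t) = 0 → t = 0 := by
    intro t ht
    have e : trace (tᵀ * c * t) = ∑ i, (N i)⁻¹ * trace ((A i * t)ᵀ * (A i * t)) := by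
      rw [hc, avg, Finset.mul_sum, Finset.sum_mul, trace_sum]
      refine Finset.sum_congr rfl fun i _ => ?_
      rw [mul_smul_comm, smul_mul_assoc, trace_smul, smul_eq_mul, transpose_mul, Matrix.mul_one]
      simp only [Matrix.mul_assoc]
    have nn : ∀ M : Matrix V V ℝ, 0 ≤ trace (Mᵀ * M) := by
      intro M
      simp only [trace, diag_apply, mul_apply, transpose_apply]
      exact Finset.sum_nonneg fun i _ => Finset.sum_nonneg fun j _ => mul_self_nonneg _
    rw [e, Finset.sum_eq_zero_iff_of_nonneg
      (fun i _ => mul_nonneg (inv_nonneg.2 (hpos i).le) (nn _))] at ht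
    apply hinj
    intro i
    have h := ht i (Finset.mem_univ i)
    rcases mul_eq_zero.1 h with h | h
    · exact absurd h (inv_ne_zero (hpos i).ne')
    · rw [← conjTranspose_eq_transpose_of_trivial] at h
      exact trace_conjTranspose_mul_self_eq_zero_iff.1 h
  have hunit : IsUnit c := by
    rw [Matrix.isUnit_iff_isUnit_det, isUnit_iff_ne_zero]
    intro hdet
    obtain ⟨v, hv, hcv⟩ := exists_mulVec_eq_zero_iff.2 hdet
    apply hv
    have : (Matrix.of fun i (_ : V) => v i) = 0 := by
      apply hquad
      have : c * (Matrix.of fun i (_ : V) => v i) = 0 := by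
        ext i j
        exact congrFun hcv i
      rw [Matrix.mul_assoc, this]
      simp
    funext i
    exact congrFun (congrFun this i) i
  obtain ⟨y, hy1, hy2⟩ := (isUnit_iff_exists.1 hunit)
  have hcc : ∀ j, A j * c = c * A j := hcomm 1
  have hyc : ∀ j, A j * y = y * A j := by
    intro j
    calc A j * y = (y * c) * A j * y := by rw [hy2, Matrix.one_mul]
      _ = y * (A j * c) * y := by rw [hcc, Matrix.mul_assoc y]
      _ = y * A j * (c * y) := by simp only [Matrix.mul_assoc]
      _ = y * A j := by rw [hy1, Matrix.mul_one]
  have hsc : ∀ j, A j * s = s * A j := hcomm d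
  have hcs : c * s = s * c := by rw [← hcen s hsc, hcen' s hsc]
  have hys : y * s = s * y := by
    calc y * s = y * (s * c) * y := by
          rw [Matrix.mul_assoc, Matrix.mul_assoc, hy1, Matrix.mul_one]
      _ = (y * c) * s * y := by rw [← hcs]; simp only [Matrix.mul_assoc]
      _ = s * y := by rw [hy2, Matrix.one_mul]
  have hct : cᵀ = c := hsymm 1 transpose_one
  have hst : sᵀ = s := hsymm d hd
  have hyt : yᵀ = y := by
    have h1 : yᵀ * c = 1 := by rw [← hct, ← transpose_mul, hy1, transpose_one]
    calc yᵀ = yᵀ * (c * y) := by rw [hy1, Matrix.mul_one]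
      _ = y := by rw [← Matrix.mul_assoc, h1, Matrix.one_mul]
  have hsy : ∀ j, A j * (s * y) = s * y * A j := by
    intro j
    rw [← Matrix.mul_assoc, hsc, Matrix.mul_assoc, hyc, Matrix.mul_assoc]
  have ht : y * s = 0 := by
    apply hquad
    rw [transpose_mul, hst, hyt, Matrix.mul_assoc, ← Matrix.mul_assoc c, hy1, Matrix.one_mul,
      trace_mul_comm, hs, hadj, ← hs, hcen _ hsy, ← Matrix.mul_assoc c, hcs, Matrix.mul_assoc s,
      hy1, Matrix.mul_one, trace_mul_comm]
    exact h0
  have : trace (s * y) = trace d := by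
    rw [hs, hadj, hcen y hyc, hy1, Matrix.mul_one]
  rw [← this, ← hys, ht, trace_zero]

end Core

section Concrete
open Matrix

/-- Real adjacency matrix. -/
noncomputable def radj {V : Type*} (R : Set (V × V)) : Matrix V V ℝ :=
  fun u v => if (u, v) ∈ R then 1 else 0

/-- Real diagonal idempotent. -/
noncomputable def rid {V : Type*} (X : Set V) : Matrix V V ℝ :=
  Matrix.diagonal fun u => if u ∈ X then 1 else 0

lemma radj_mul {V : Type*} [Fintype V] (R S : Set (V × V)) (u v : V) :
    (radj R * radj S) u v = (iNum R S (u, v) : ℝ) := by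
  simp only [Matrix.mul_apply, radj, iNum]
  rw [Nat.card_eq_fintype_card, Fintype.card_subtype, Finset.card_filter]
  push_cast
  refine Finset.sum_congr rfl fun w _ => ?_
  by_cases h1 : (u, w) ∈ R <;> by_cases h2 : (w, v) ∈ S <;> simp [h1, h2]

lemma radj_transp {V : Type*} (R : Set (V × V)) : radj (transp R) = (radj R)ᵀ := by
  ext u v
  simp [radj, transp]

lemma trace_mul_transpose_radj {V : Type*} [Fintype V] (M : Matrix V V ℝ) (T : Set (V × V)) :
    trace (M * (radj T)ᵀ) = ∑ p : V × V, if p ∈ T then M p.1 p.2 else 0 := by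
  rw [Fintype.sum_prod_type]
  simp only [trace, Matrix.diag_apply, Matrix.mul_apply, transpose_apply, radj]
  simp

lemma trace_rid {V : Type*} [Fintype V] (X : Set V) : trace (rid X) = (Nat.card X : ℝ) := by
  rw [rid, trace_diagonal, Nat.card_eq_fintype_card, Fintype.card_subtype, Finset.card_filter]
  push_cast
  rfl

lemma trace_four {V : Type*} [Fintype V] (R : Set (V × V)) (X Y : Set V) :
    trace ((radj R)ᵀ * rid X * radj R * rid Y)
      = ∑ p : V × V, if p ∈ R then (if p ∈ X ×ˢ Y then (1 : ℝ) else 0) else 0 := by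
  rw [Matrix.mul_assoc, Matrix.mul_assoc, trace_mul_comm, trace_mul_transpose_radj]
  refine Finset.sum_congr rfl fun p _ => ?_
  obtain ⟨u, v⟩ := p
  simp only [rid, Matrix.mul_diagonal, Matrix.diagonal_mul, radj,
    Set.mem_prod]
  by_cases h1 : (u, v) ∈ R <;> by_cases h2 : u ∈ X <;> by_cases h3 : v ∈ Y <;> simp [h1, h2, h3]

/-- Weights. -/
noncomputable def wt {V : Type*} (R : Set (V × V)) : ℝ := (Nat.card R : ℝ)

lemma wt_sum {V : Type*} [Fintype V] (R : Set (V × V)) :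
    wt R = ∑ p : V × V, if p ∈ R then (1 : ℝ) else 0 := by
  rw [wt, Nat.card_eq_fintype_card, Fintype.card_subtype, Finset.card_filter]
  push_cast
  rfl

lemma rel_left {V : Type*} [Fintype V] {ℛ : Set (Set (V × V))} (hCC : IsCC ℛ) {X : Set V}
    (hX : IsFiber ℛ X) {R : Set (V × V)} (hR : R ∈ ℛ) {p q : V × V} (hp : p ∈ R) (hq : q ∈ R)
    (h : p.1 ∈ X) : q.1 ∈ X := by
  have e := hCC.2.2.2.2 _ hX.2 R hR R hR p hp q hq
  by_contra hn
  have h1 : iNum (diag X) R q = 0 := by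
    rw [iNum, Nat.card_eq_zero]
    left
    refine ⟨fun w => ?_⟩
    exact hn w.2.1.1
  have h2 : iNum (diag X) R p ≠ 0 := by
    rw [iNum]
    have : Nonempty {w : V | (p.1, w) ∈ diag X ∧ (w, p.2) ∈ R} := ⟨⟨p.1, ⟨h, rfl⟩, hp⟩⟩
    exact Nat.card_pos.ne'
  omega

lemma rel_right {V : Type*} [Fintype V] {ℛ : Set (Set (V × V))} (hCC : IsCC ℛ) {X : Set V}
    (hX : IsFiber ℛ X) {R : Set (V × V)} (hR : R ∈ ℛ) {p q : V × V} (hp : p ∈ R) (hq : q ∈ R)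
    (h : p.2 ∈ X) : q.2 ∈ X :=
  rel_left hCC hX (hCC.2.2.2.1 R hR) (p := p.swap) (q := q.swap) hp hq h

lemma fiber_card_eq {V : Type*} [Fintype V] (ℛ : Set (Set (V × V))) (hCC : IsCC ℛ)
    (hbal : IsBalanced ℛ) (X Y : Set V) (hX : IsFiber ℛ X) (hY : IsFiber ℛ Y) :
    Nat.card X = Nat.card Y := by
  obtain ⟨r, hr⟩ := hbal
  have hpos : ∀ i : ℛ, 0 < wt i.1 := by
    intro i
    have : Nonempty i.1 := (hCC.1 i.1 i.2).to_subtype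
    rw [wt]
    exact_mod_cast Nat.card_pos
  have htt : ∀ R : Set (V × V), transp (transp R) = R := fun R => by ext p; simp [transp]
  let τ : ℛ ≃ ℛ := ⟨fun i => ⟨transp i.1, hCC.2.2.2.1 _ i.2⟩,
    fun i => ⟨transp i.1, hCC.2.2.2.1 _ i.2⟩, fun i => Subtype.ext (htt _),
    fun i => Subtype.ext (htt _)⟩
  have huniq : ∀ (p : V × V) (R S : Set (V × V)), R ∈ ℛ → S ∈ ℛ → p ∈ R → p ∈ S → R = S := by
    intro p R S hR hS h1 h2
    exact (hCC.2.1 p).unique ⟨hR, h1⟩ ⟨hS, h2⟩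
  -- counting
  have hcount : ∀ X Y : Set V, IsFiber ℛ X → IsFiber ℛ Y →
      trace (avg (fun i : ℛ => radj i.1) (fun i => wt i.1) (rid X) * rid Y) = (r : ℝ) := by
    intro X Y hX hY
    rw [← hr X Y hX hY, avg, Finset.sum_mul, trace_sum]
    have : ∀ i : ℛ, trace (((wt i.1)⁻¹ • ((radj i.1)ᵀ * rid X * radj i.1)) * rid Y)
        = if i.1 ⊆ X ×ˢ Y then 1 else 0 := by
      intro i
      rw [smul_mul_assoc, trace_smul, trace_four, smul_eq_mul]
      obtain ⟨p, hp⟩ := hCC.1 i.1 i.2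
      split_ifs with h
      · refine Eq.trans ?_ (inv_mul_cancel₀ (hpos i).ne')
        congr 1
        rw [wt_sum]
        refine Finset.sum_congr rfl fun q _ => ?_
        by_cases hq : q ∈ i.1
        · simp [hq, h hq, -Set.mem_prod]
        · simp [hq]
      · rw [Finset.sum_eq_zero, mul_zero]
        intro q _
        by_cases hq : q ∈ i.1
        · rw [if_pos hq, if_neg]
          intro hq'
          apply h
          intro q2 hq2
          exact ⟨rel_left hCC hX i.2 hq hq2 hq'.1, rel_right hCC hY i.2 hq hq2 hq'.2⟩
        · simp [hq]
    rw [Finset.sum_congr rfl fun i _ => this i]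
    have e : Nat.card (relsBtw ℛ X Y) = Nat.card {i : ℛ // i.1 ⊆ X ×ˢ Y} := by
      refine Nat.card_congr ⟨fun R => ⟨⟨R.1, R.2.1⟩, R.2.2⟩, fun i => ⟨i.1.1, i.1.2, i.2⟩,
        fun _ => rfl, fun _ => rfl⟩
    rw [e, Nat.card_eq_fintype_card, Fintype.card_subtype, Finset.card_filter]
    push_cast
    rfl
  have hmain : trace (rid X - rid Y) = 0 := by
    refine core (fun i : ℛ => radj i.1) (fun i => wt i.1) hpos τ (fun i => radj_transp _) ?_ ?_ ?_
      (rid X - rid Y) ?_ ?_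
    · intro i
      rw [wt_sum, wt_sum, ← Equiv.sum_comp (Equiv.prodComm V V)]
      rfl
    · intro i j
      ext u v
      obtain ⟨T, ⟨hT, huv⟩, hT'⟩ := hCC.2.1 (u, v)
      rw [Matrix.sum_apply, Finset.sum_eq_single (⟨T, hT⟩ : ℛ)]
      · rw [Matrix.smul_apply, trace_mul_transpose_radj, radj_mul]
        have : (∑ p : V × V, if p ∈ T then (radj i.1 * radj j.1) p.1 p.2 else 0)
            = iNum i.1 j.1 (u, v) * wt T := by
          rw [wt_sum, Finset.mul_sum]
          refine Finset.sum_congr rfl fun p _ => ?_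
          by_cases hp : p ∈ T
          · simp only [hp, if_true, mul_one]
            rw [radj_mul]
            exact_mod_cast hCC.2.2.2.2 _ i.2 _ j.2 T hT p hp _ huv
          · simp [hp]
        simp only [this]
        rw [mul_assoc, mul_inv_cancel₀ (hpos ⟨T, hT⟩).ne']
        simp [radj, huv]
      · intro k _ hk
        have : (u, v) ∉ k.1 := fun h => hk (Subtype.ext (huniq _ _ _ k.2 hT h huv))
        simp [radj, this]
      · simp
    · intro x hx
      ext u v
      obtain ⟨T, ⟨hT, huv⟩, hT'⟩ := hCC.2.1 (u, u)
      have h := congrFun (congrFun (hx ⟨T, hT⟩) u) v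
      rw [Matrix.mul_apply, Finset.sum_eq_single u] at h
      · simpa [radj, huv] using h
      · intro w _ hw
        have : (u, w) ∉ T := fun h => hw (hCC.2.2.1 T hT ⟨_, huv, rfl⟩ _ h).symm
        simp [radj, this]
      · simp
    · simp [rid]
    · have hsub : ∀ x y : Matrix V V ℝ, avg (fun i : ℛ => radj i.1) (fun i => wt i.1) (x - y) =
          avg (fun i : ℛ => radj i.1) (fun i => wt i.1) x -
          avg (fun i : ℛ => radj i.1) (fun i => wt i.1) y := by
        intro x y
        simp only [avg, ← Finset.sum_sub_distrib, ← smul_sub, Matrix.mul_sub, Matrix.sub_mul]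
      rw [hsub, Matrix.sub_mul, Matrix.mul_sub, Matrix.mul_sub, trace_sub, trace_sub, trace_sub,
        hcount X X hX hX, hcount X Y hX hY, hcount Y X hY hX, hcount Y Y hY hY]
      ring
  rw [trace_sub, trace_rid, trace_rid, sub_eq_zero] at hmain
  exact_mod_cast hmain

end Concrete

/-- **Theorem (Statement 7).** A balanced coherent configuration is half-homogeneous:
all fibers have the same size, namely `|X| = |V| / |Fib(𝒞)|` for each fiber `X`. -/
theorem balanced_half_homogeneous
    {V : Type*} [Fintype V] [Nonempty V]
    (ℛ : Set (Set (V × V))) (hCC : IsCC ℛ) (hbal : IsBalanced ℛ) :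
    (∀ X Y : Set V, IsFiber ℛ X → IsFiber ℛ Y → Nat.card X = Nat.card Y) ∧
    ∀ X : Set V, IsFiber ℛ X →
      Nat.card X * Nat.card {Y : Set V | IsFiber ℛ Y} = Fintype.card V := by
  have key := fiber_card_eq ℛ hCC hbal
  refine ⟨key, fun X hX => ?_⟩
  have hex : ∀ v : V, ∃ Y : {Y : Set V | IsFiber ℛ Y}, v ∈ Y.1 := by
    intro v
    obtain ⟨T, ⟨hT, hv⟩, -⟩ := hCC.2.1 (v, v)
    have hd : diag {u | (u, u) ∈ T} = T := by
      ext ⟨a, b⟩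
      constructor
      · rintro ⟨h1, h2⟩
        have h2' : a = b := h2
        subst h2'
        exact h1
      · intro h
        have h2 : a = b := hCC.2.2.1 T hT ⟨_, hv, rfl⟩ _ h
        subst h2
        exact ⟨h, rfl⟩
    exact ⟨⟨{u | (u, u) ∈ T}, ⟨v, hv⟩, by rw [hd]; exact hT⟩, hv⟩
  have huniq : ∀ (v : V) (Y Z : {Y : Set V | IsFiber ℛ Y}), v ∈ Y.1 → v ∈ Z.1 → Y = Z := by
    intro v Y Z h1 h2
    have e : diag Y.1 = diag Z.1 :=
      (hCC.2.1 (v, v)).unique ⟨Y.2.2, h1, rfl⟩ ⟨Z.2.2, h2, rfl⟩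
    apply Subtype.ext
    ext w
    have hw : (w, w) ∈ diag Y.1 ↔ (w, w) ∈ diag Z.1 := by rw [e]
    simpa [diag] using hw
  choose f hf using hex
  have e : V ≃ Σ Y : {Y : Set V | IsFiber ℛ Y}, Y.1 :=
    ⟨fun v => ⟨f v, v, hf v⟩, fun s => s.2.1, fun _ => rfl, by
      rintro ⟨Y, v, hv⟩
      have := huniq v _ _ (hf v) hv
      subst this
      rfl⟩
  rw [← Nat.card_eq_fintype_card, Nat.card_congr e, Nat.card_sigma,
    Finset.sum_congr rfl fun Y _ => key Y.1 X Y.2 hX]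
  simp [mul_comm]

end CCPaper
end

section
/- Let 𝒞 be an (m,n,r)-scheme with r ≥ 1. If m is prime, then r − 1 divides m − 1. -/
open scoped Classical

namespace CCPaper

variable {V : Type*}

set_option linter.unusedSectionVars false

namespace HS

/-- A homogeneous coherent configuration given by a colouring of pairs. -/
structure HScheme (X ι : Type*) [Fintype X] [DecidableEq ι] where
  c : X → X → ι
  z : ι
  t : ι → ι
  hz : ∀ x y, c x y = z ↔ x = y
  ht : ∀ x y, c y x = t (c x y)
  surj : ∀ i, ∃ x y, c x y = i
  reg : ∀ i j x y x' y', c x y = c x' y' →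
    (Finset.univ.filter fun w => c x w = i ∧ c w y = j).card =
    (Finset.univ.filter fun w => c x' w = i ∧ c w y' = j).card

section basic
variable {X ι : Type*} [Fintype X] [DecidableEq X] [Fintype ι] [DecidableEq ι]
  (H : HScheme X ι)

/-- Matrices constant on colours. -/
def HScheme.coh (R : Type*) [CommRing R] : Subalgebra R (Matrix X X R) where
  carrier := {M | ∃ f : ι → R, ∀ x y, M x y = f (H.c x y)}
  mul_mem' := by
    rintro M N ⟨f, hf⟩ ⟨g, hg⟩
    have key : ∀ x y, (M * N) x y = ∑ i, ∑ j, f i * g j *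
        ((Finset.univ.filter fun w => H.c x w = i ∧ H.c w y = j).card : R) := by
      intro x y
      rw [Matrix.mul_apply]
      have : ∀ i j, f i * g j *
        ((Finset.univ.filter fun w => H.c x w = i ∧ H.c w y = j).card : R)
        = ∑ w, if H.c x w = i ∧ H.c w y = j then f i * g j else 0 := by
        intro i j
        rw [← Finset.sum_filter, Finset.sum_const, nsmul_eq_mul, mul_comm]
      simp_rw [this]
      have h2 : ∀ i, ∑ j, ∑ w, (if H.c x w = i ∧ H.c w y = j then f i * g j else 0)
          = ∑ w, ∑ j, (if H.c x w = i ∧ H.c w y = j then f i * g j else 0) :=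
        fun i => Finset.sum_comm
      simp_rw [h2]
      rw [Finset.sum_comm]
      refine Finset.sum_congr rfl fun w _ => ?_
      simp [ite_and, hf, hg]
    have h3 : ∀ k, ∃ a, ∀ x y, H.c x y = k → (M * N) x y = a := by
      intro k
      obtain ⟨x, y, hxy⟩ := H.surj k
      refine ⟨(M * N) x y, fun x' y' h' => ?_⟩
      rw [key, key]
      simp_rw [H.reg _ _ x' y' x y (h'.trans hxy.symm)]
    choose a ha using h3
    exact ⟨a, fun x y => ha _ x y rfl⟩
  add_mem' := by
    rintro M N ⟨f, hf⟩ ⟨g, hg⟩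
    exact ⟨fun i => f i + g i, fun x y => by simp [hf, hg]⟩
  algebraMap_mem' := by
    intro r
    refine ⟨fun i => if i = H.z then r else 0, fun x y => ?_⟩
    simp only [H.hz, Matrix.algebraMap_matrix_apply]
    simp

/-- adjacency matrix -/
def HScheme.adj (R : Type*) [CommRing R] (i : ι) : Matrix X X R :=
  Matrix.of fun x y => if H.c x y = i then 1 else 0

/-- all ones -/
def JM (X R : Type*) [CommRing R] : Matrix X X R := Matrix.of fun _ _ => 1

/-- valency -/
noncomputable def HScheme.val [Nonempty X] (i : ι) : ℕ :=
  (Finset.univ.filter fun w => H.c (Classical.arbitrary X) w = i).card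

variable {R : Type*} [CommRing R]

theorem HScheme.adj_mem (i : ι) : H.adj R i ∈ H.coh R :=
  ⟨fun j => if j = i then 1 else 0, fun _ _ => rfl⟩

theorem HScheme.J_mem : JM X R ∈ H.coh R := ⟨fun _ => 1, fun _ _ => rfl⟩

theorem HScheme.tt (i : ι) : H.t (H.t i) = i := by
  obtain ⟨x, y, rfl⟩ := H.surj i
  rw [← H.ht, ← H.ht]

theorem HScheme.transpose_mem {M : Matrix X X R} (h : M ∈ H.coh R) : M.transpose ∈ H.coh R := by
  obtain ⟨f, hf⟩ := h
  exact ⟨fun i => f (H.t i), fun x y => by rw [Matrix.transpose_apply, hf, H.ht]⟩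

theorem HScheme.adj_transpose (i : ι) : (H.adj R i).transpose = H.adj R (H.t i) := by
  ext x y
  simp only [HScheme.adj, Matrix.transpose_apply, Matrix.of_apply]
  rw [H.ht x y]
  have : H.t (H.c x y) = i ↔ H.c x y = H.t i :=
    ⟨fun h => by rw [← h, H.tt], fun h => by rw [h, H.tt]⟩
  simp [this]

variable [Nonempty X]

theorem HScheme.card_row (i : ι) (x : X) :
    (Finset.univ.filter fun w => H.c x w = i).card = H.val i := by
  have : ∀ x, (Finset.univ.filter fun w => H.c x w = i) =
    (Finset.univ.filter fun w => H.c x w = i ∧ H.c w x = H.t i) := by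
    intro x
    ext w
    simp only [Finset.mem_filter, Finset.mem_univ, true_and]
    constructor
    · intro h; exact ⟨h, by rw [H.ht x w, h]⟩
    · exact fun h => h.1
  rw [HScheme.val, this, this]
  exact H.reg _ _ _ _ _ _ (((H.hz x x).2 rfl).trans ((H.hz _ _).2 rfl).symm)

theorem HScheme.adj_J (i : ι) : H.adj R i * JM X R = (H.val i : R) • JM X R := by
  ext x y
  simp only [Matrix.mul_apply, HScheme.adj, JM, Matrix.of_apply, Matrix.smul_apply, mul_one,
    smul_eq_mul]
  rw [← H.card_row i x, Finset.sum_boole]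

theorem HScheme.val_t (i : ι) : H.val (H.t i) = H.val i := by
  have h1 : ∀ i, (Finset.univ.filter fun p : X × X => H.c p.1 p.2 = i).card
      = Fintype.card X * H.val i := by
    intro i
    rw [Finset.card_filter, Fintype.sum_prod_type]
    simp_rw [← Finset.card_filter, H.card_row]
    simp
  have h2 : (Finset.univ.filter fun p : X × X => H.c p.1 p.2 = H.t i).card =
     (Finset.univ.filter fun p : X × X => H.c p.1 p.2 = i).card := by
    refine Finset.card_bij (fun p _ => p.swap) ?_ ?_ ?_
    · rintro ⟨x, y⟩ h
      simp only [Finset.mem_filter, Finset.mem_univ, true_and, Prod.swap] at h ⊢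
      rw [H.ht x y, h, H.tt]
    · intro a _ b _ h; exact Prod.swap_injective h
    · rintro ⟨x, y⟩ h
      refine ⟨⟨y, x⟩, ?_, rfl⟩
      simp only [Finset.mem_filter, Finset.mem_univ, true_and] at h ⊢
      rw [H.ht x y, h]
  rw [h1, h1] at h2
  exact Nat.eq_of_mul_eq_mul_left Fintype.card_pos h2

theorem HScheme.val_pos (i : ι) : 0 < H.val i := by
  obtain ⟨x, y, h⟩ := H.surj i
  rw [← H.card_row i x]
  exact Finset.card_pos.2 ⟨y, by simp [h]⟩

theorem HScheme.val_z : H.val H.z = 1 := by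
  rw [HScheme.val]
  simp only [H.hz]
  rw [Finset.card_eq_one]
  exact ⟨Classical.arbitrary X, by ext; simp [eq_comm]⟩

theorem HScheme.val_lt (hp : 1 < Fintype.card X) (i : ι) : H.val i < Fintype.card X := by
  by_cases hi : i = H.z
  · rw [hi, H.val_z]; exact hp
  · rw [HScheme.val, ← Finset.card_univ]
    apply Finset.card_lt_card
    rw [Finset.filter_ssubset]
    refine ⟨Classical.arbitrary X, Finset.mem_univ _, fun h => hi ?_⟩
    rw [← h, H.hz]

theorem HScheme.sum_val : ∑ i, H.val i = Fintype.card X := by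
  simp_rw [HScheme.val]
  rw [← Finset.card_univ, ← Finset.card_eq_sum_card_fiberwise]
  simp

theorem JJ : JM X R * JM X R = (Fintype.card X : R) • JM X R := by
  ext x y; simp [JM, Matrix.mul_apply]

theorem HScheme.mem_sum {M : Matrix X X R} {f : ι → R} (hf : ∀ x y, M x y = f (H.c x y)) :
    M = ∑ i, f i • H.adj R i := by
  ext x y
  rw [hf, Matrix.sum_apply]
  simp [HScheme.adj]

theorem HScheme.J_adj (i : ι) : JM X R * H.adj R i = (H.val i : R) • JM X R := by
  have h := congrArg Matrix.transpose (H.adj_J (R := R) (H.t i))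
  rw [Matrix.transpose_mul, H.adj_transpose, H.tt, H.val_t] at h
  exact h

theorem HScheme.J_comm {M : Matrix X X R} (h : M ∈ H.coh R) : JM X R * M = M * JM X R := by
  obtain ⟨f, hf⟩ := h
  rw [H.mem_sum hf, Finset.mul_sum, Finset.sum_mul]
  simp [H.J_adj, H.adj_J]

/-- trace against a transposed adjacency matrix -/
theorem HScheme.trace_mul_adj {M : Matrix X X R} {f : ι → R} (hf : ∀ x y, M x y = f (H.c x y))
    (i : ι) : (M * H.adj R (H.t i)).trace = (Fintype.card X : R) * H.val i * f i := by
  rw [← H.adj_transpose, Matrix.trace]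
  simp only [Matrix.diag_apply, Matrix.mul_apply, Matrix.transpose_apply, HScheme.adj,
    Matrix.of_apply, hf]
  have : ∀ x, ∑ y, f (H.c x y) * (if H.c x y = i then (1 : R) else 0) = H.val i * f i := by
    intro x
    rw [← H.card_row i x, ← nsmul_eq_mul, ← Finset.sum_const, Finset.sum_filter]
    refine Finset.sum_congr rfl fun y _ => ?_
    split_ifs with h <;> simp [h]
  simp_rw [this]
  simp [mul_assoc]

theorem HScheme.trace_mem {M : Matrix X X R} {f : ι → R} (hf : ∀ x y, M x y = f (H.c x y)) :
    M.trace = (Fintype.card X : R) * f H.z := by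
  simp [Matrix.trace, hf, (H.hz _ _).2 rfl]

theorem HScheme.trace_adj {i : ι} (hi : i ≠ H.z) : (H.adj R i).trace = 0 := by
  rw [H.trace_mem (M := H.adj R i) (f := fun j => if j = i then 1 else 0) (fun _ _ => rfl)]
  simp [hi.symm]

end basic

section lattice
variable {X : Type*} [Fintype X] [DecidableEq X]

/-- the cast map on vectors -/
def castV (X : Type*) : (X → ℤ) →ₗ[ℤ] (X → ℚ) where
  toFun v x := (v x : ℚ)
  map_add' u v := by ext; simp
  map_smul' u v := by ext; simp

/-- integer matrices over the rationals -/
def qm (A : Matrix X X ℤ) : Matrix X X ℚ := A.map (Int.castRingHom ℚ)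

theorem castV_mulVec (A : Matrix X X ℤ) (v : X → ℤ) :
    castV X (A.mulVec v) = (qm A).mulVec (castV X v) := by
  ext x
  simp [castV, qm, Matrix.mulVec, dotProduct]

theorem castV_inj : Function.Injective (castV X) := by
  intro u v h
  ext x
  have := congrFun h x
  simpa [castV] using this

theorem trace_int (U : Submodule ℚ (X → ℚ)) (A : Matrix X X ℤ)
    (hA : ∀ u ∈ U, Matrix.toLin' (qm A) u ∈ U) :
    ∃ t : ℤ, LinearMap.trace ℚ U ((Matrix.toLin' (qm A)).restrict hA) = t ∧
      ∀ (p N : ℕ) (C : Matrix X X ℤ), p.Prime → A ^ N = (p : ℤ) • C → (p : ℤ) ∣ t := by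
  let L : Submodule ℤ (X → ℤ) := (U.restrictScalars ℤ).comap (castV X)
  obtain ⟨d, b⟩ := Submodule.basisOfPid (Pi.basisFun ℤ X) L
  have memL : ∀ v, v ∈ L ↔ castV X v ∈ U := fun v => Iff.rfl
  let bU : Fin d → U := fun i => ⟨castV X (b i), (b i).2⟩
  have liZ : LinearIndependent ℤ bU := by
    have h1 : LinearIndependent ℤ (fun i => castV X (b i : X → ℤ)) := by
      have h2 := b.linearIndependent.map' (castV X ∘ₗ L.subtype) (by
        rw [LinearMap.ker_eq_bot]
        exact castV_inj.comp L.subtype_injective)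
      exact h2
    exact LinearIndependent.of_comp (U.subtype.restrictScalars ℤ) h1
  have liQ : LinearIndependent ℚ bU := (LinearIndependent.iff_fractionRing ℤ ℚ).1 liZ
  have sp : ⊤ ≤ Submodule.span ℚ (Set.range bU) := by
    rintro ⟨u, hu⟩ -
    obtain ⟨k, hk⟩ := IsLocalization.exist_integer_multiples_of_finite (nonZeroDivisors ℤ) u
    choose v hv using hk
    have hk0 : ((k : ℤ) : ℚ) ≠ 0 := by
      have := nonZeroDivisors.coe_ne_zero k
      exact_mod_cast this
    have hv' : castV X v = ((k : ℤ) : ℚ) • u := by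
      ext x
      have := hv x
      simp [castV] at this ⊢
      exact this
    have hvL : v ∈ L := by
      rw [memL, hv']
      exact U.smul_mem _ hu
    have hs := b.sum_repr ⟨v, hvL⟩
    have hs2 : ∑ i, ((b.repr ⟨v, hvL⟩ i : ℤ) : ℚ) • bU i = ((k : ℤ) : ℚ) • (⟨u, hu⟩ : U) := by
      apply Subtype.ext
      have h3 := congrArg (fun w : L => castV X (w : X → ℤ)) hs
      simp only [hv', Submodule.coe_sum, Submodule.coe_smul, map_sum, map_smul] at h3
      simp only [Submodule.coe_sum, Submodule.coe_smul, bU, Int.cast_smul_eq_zsmul] 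
      simpa only [Int.cast_smul_eq_zsmul] using h3
    have h4 : (⟨u, hu⟩ : U) = ((k : ℤ) : ℚ)⁻¹ • ∑ i, ((b.repr ⟨v, hvL⟩ i : ℤ) : ℚ) • bU i := by
      rw [hs2, inv_smul_smul₀ hk0]
    rw [h4]
    exact Submodule.smul_mem _ _ (Submodule.sum_mem _ fun i _ =>
      Submodule.smul_mem _ _ (Submodule.subset_span ⟨i, rfl⟩))
  let BU := Module.Basis.mk liQ sp
  have hBU : ∀ i, BU i = bU i := fun i => by simp [BU]
  have resL : ∀ B : Matrix X X ℤ, (∀ u ∈ U, Matrix.toLin' (qm B) u ∈ U) →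
      ∀ v ∈ L, Matrix.toLin' B v ∈ L := by
    intro B hB v hv
    rw [memL, Matrix.toLin'_apply, castV_mulVec]
    exact hB _ hv
  let m : Matrix (Fin d) (Fin d) ℤ :=
    LinearMap.toMatrix b b ((Matrix.toLin' A).restrict (resL A hA))
  have hm : LinearMap.toMatrix BU BU ((Matrix.toLin' (qm A)).restrict hA)
      = m.map (Int.castRingHom ℚ) := by
    have : ((Matrix.toLin' (qm A)).restrict hA) =
        Matrix.toLin BU BU (m.map (Int.castRingHom ℚ)) := by
      refine BU.ext fun j => ?_
      rw [Matrix.toLin_self]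
      apply Subtype.ext
      have h5 : (Matrix.toLin' A).restrict (resL A hA) (b j) = ∑ i, m i j • b i := by
        rw [← Matrix.toLin_self b b, Matrix.toLin_toMatrix]
      have h6 := congrArg (fun w : L => castV X (w : X → ℤ)) h5
      simp only [LinearMap.coe_restrict_apply, Matrix.toLin'_apply, castV_mulVec,
        Submodule.coe_sum, Submodule.coe_smul, map_sum, map_smul] at h6
      simp only [hBU, LinearMap.coe_restrict_apply, Matrix.toLin'_apply, bU,
        Submodule.coe_sum, Submodule.coe_smul, Matrix.map_apply, eq_intCast,
        Int.cast_smul_eq_zsmul]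
      exact h6
    rw [this, LinearMap.toMatrix_toLin]
  refine ⟨m.trace, ?_, ?_⟩
  · rw [LinearMap.trace_eq_matrix_trace ℚ BU, hm]
    simp [Matrix.trace]
  · intro p N C hp hC
    have := Fact.mk hp
    have hCL : ∀ v ∈ L, Matrix.toLin' C v ∈ L := by
      intro v hv
      have h7 : ∀ n, (A ^ n).mulVec v ∈ L := by
        intro n
        induction n with
        | zero => simpa using hv
        | succ n ih =>
          rw [pow_succ', ← Matrix.mulVec_mulVec]
          exact resL A hA _ ih
      have h8 := h7 N
      rw [hC, Matrix.smul_mulVec, memL, map_smul] at h8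
      rw [memL, Matrix.toLin'_apply]
      have h9 := U.smul_mem ((p : ℚ)⁻¹) h8
      have : ((p : ℚ)⁻¹) • ((p : ℤ) • castV X (C.mulVec v)) = castV X (C.mulVec v) := by
        rw [← Int.cast_smul_eq_zsmul ℚ, Int.cast_natCast, inv_smul_smul₀]
        exact_mod_cast hp.ne_zero
      rwa [this] at h9
    have hpow : m ^ N = (p : ℤ) • LinearMap.toMatrix b b ((Matrix.toLin' C).restrict hCL) := by
      have : ((Matrix.toLin' A).restrict (resL A hA)) ^ N
          = (p : ℤ) • ((Matrix.toLin' C).restrict hCL) := by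
        rw [Module.End.pow_restrict]
        ext1 v
        apply Subtype.ext
        have : (Matrix.toLin' A) ^ N = (p : ℤ) • Matrix.toLin' C := by
          rw [← Matrix.toLin'_pow, hC, map_smul]
        simp [LinearMap.coe_restrict_apply, this]
      rw [← map_smul, ← this, ← LinearMap.toMatrix_pow]
    have hnil : IsNilpotent (m.map (Int.castRingHom (ZMod p))) := by
      refine ⟨N, ?_⟩
      have := congrArg (fun M => (Int.castRingHom (ZMod p)).mapMatrix M) hpow
      simp only [map_pow, RingHom.mapMatrix_apply] at this
      rw [this]
      ext i j
      rw [Matrix.map_apply, Matrix.smul_apply, smul_eq_mul]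
      simp
    have h10 := (Matrix.isNilpotent_trace_of_isNilpotent hnil).eq_zero
    rw [← ZMod.intCast_zmod_eq_zero_iff_dvd]
    simpa [Matrix.trace] using h10

end lattice

section idem

theorem exists_idem_pow {M : Type*} [Monoid M] [Finite M] (a : M) :
    ∃ k, 0 < k ∧ a ^ k * a ^ k = a ^ k := by
  obtain ⟨i, j, hij, h⟩ := Finite.exists_ne_map_eq_of_infinite (fun n : ℕ => a ^ n)
  wlog hlt : i < j generalizing i j
  · exact this j i hij.symm h.symm (lt_of_le_of_ne (not_lt.1 hlt) hij.symm)
  obtain ⟨d, rfl⟩ := Nat.exists_eq_add_of_lt hlt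
  have h' : a ^ i = a ^ (i + (d + 1)) := h
  have step : ∀ k, a ^ (i + k) = a ^ (i + k + (d + 1)) := by
    intro k
    have : i + k + (d + 1) = (i + (d + 1)) + k := by ring
    rw [this, pow_add, h', ← pow_add]
  have many : ∀ t k, a ^ (i + k) = a ^ (i + k + (d + 1) * t) := by
    intro t
    induction t with
    | zero => intro k; simp
    | succ t ih =>
      intro k
      rw [ih, add_assoc, step]
      congr 1; ring
  refine ⟨(d + 1) * (i + 1), by positivity, ?_⟩
  rw [← pow_add]
  have e : (d + 1) * (i + 1) = i + (d * (i + 1) + 1) := by ring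
  have := many (i + 1) (d * (i + 1) + 1)
  rw [← e] at this
  exact this.symm

variable {X ι : Type*} [Fintype X] [DecidableEq X] [Fintype ι] [DecidableEq ι] [Nonempty X]
  (H : HScheme X ι)

theorem trace_idem {K : Type*} [Field K] {e : Matrix X X K} (he : e * e = e) :
    e.trace = (Module.finrank K (LinearMap.range (Matrix.toLin' e)) : K) := by
  have : IsIdempotentElem (Matrix.toLin' e) := by
    rw [IsIdempotentElem, Module.End.mul_eq_comp, ← Matrix.toLin'_mul, he]
  rw [← (LinearMap.IsIdempotentElem.isProj_range _ this).trace, Matrix.trace_toLin'_eq]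

theorem rank_lt {K : Type*} [Field K] {e : Matrix X X K} (hJ : e * JM X K = 0) :
    Module.finrank K (LinearMap.range (Matrix.toLin' e)) < Fintype.card X := by
  have h1 := LinearMap.finrank_range_add_finrank_ker (Matrix.toLin' e)
  rw [Module.finrank_fintype_fun_eq_card] at h1
  have h2 : 0 < Module.finrank K (LinearMap.ker (Matrix.toLin' e)) := by
    rw [Module.finrank_pos_iff_exists_ne_zero]
    refine ⟨⟨fun _ => 1, ?_⟩, ?_⟩
    · rw [LinearMap.mem_ker]
      ext x
      have := congrFun (congrFun hJ x) x
      simpa [Matrix.mul_apply, JM, Matrix.mulVec, dotProduct] using this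
    · intro h
      have := congrFun (congrArg Subtype.val h) (Classical.arbitrary X)
      simp at this
  omega

theorem HScheme.nil (hp : (Fintype.card X).Prime) (i : ι) :
    ∃ (N : ℕ) (C : Matrix X X ℤ),
      (H.adj ℤ i - (H.val i : ℤ) • 1) ^ N = ((Fintype.card X : ℕ) : ℤ) • C := by
  set p := Fintype.card X with hpd
  have := Fact.mk hp
  set M : Matrix X X (ZMod p) := H.adj (ZMod p) i - (H.val i : ZMod p) • 1 with hM
  have hMmem : M ∈ H.coh (ZMod p) :=
    sub_mem (H.adj_mem i) (Subalgebra.smul_mem _ (one_mem _) _)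
  have hMJ : M * JM X (ZMod p) = 0 := by
    rw [hM, sub_mul, H.adj_J, smul_mul_assoc, one_mul, sub_self]
  obtain ⟨k, hk, he⟩ := exists_idem_pow M
  have hemem : M ^ k ∈ H.coh (ZMod p) := pow_mem hMmem k
  have heJ : M ^ k * JM X (ZMod p) = 0 := by
    obtain ⟨k, rfl⟩ := Nat.exists_eq_succ_of_ne_zero hk.ne'
    rw [pow_succ, mul_assoc, hMJ, mul_zero]
  have h1 := trace_idem he
  obtain ⟨f, hf⟩ := hemem
  rw [H.trace_mem hf, ← hpd, ZMod.natCast_self, zero_mul, eq_comm,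
    ZMod.natCast_eq_zero_iff] at h1
  have h2 := Nat.eq_zero_of_dvd_of_lt h1 (rank_lt heJ)
  rw [Submodule.finrank_eq_zero, LinearMap.range_eq_bot] at h2
  have h3 : M ^ k = 0 := by
    exact (LinearEquiv.map_eq_zero_iff Matrix.toLin').1 h2
  have h4 : M = (Int.castRingHom (ZMod p)).mapMatrix (H.adj ℤ i - (H.val i : ℤ) • 1) := by
    ext x y
    simp only [hM, HScheme.adj, RingHom.mapMatrix_apply, Matrix.map_apply, Matrix.sub_apply,
      Matrix.smul_apply, Matrix.of_apply, Matrix.one_apply]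
    split_ifs <;> simp
  rw [h4, ← map_pow] at h3
  have h5 : ∀ x y, ∃ c : ℤ, ((H.adj ℤ i - (H.val i : ℤ) • 1) ^ k) x y = (p : ℤ) * c := by
    intro x y
    have := congrFun (congrFun h3 x) y
    simp only [RingHom.mapMatrix_apply, Matrix.map_apply, eq_intCast, Matrix.zero_apply] at this
    rwa [ZMod.intCast_zmod_eq_zero_iff_dvd] at this
  choose C hC using h5
  exact ⟨k, C, by ext x y; rw [hC]; rfl⟩

theorem qm_adj (i : ι) : qm (H.adj ℤ i) = H.adj ℚ i := by
  ext x y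
  simp only [qm, HScheme.adj, Matrix.map_apply, Matrix.of_apply]
  split_ifs <;> simp

theorem HScheme.trace_sub (hp : (Fintype.card X).Prime) (U : Submodule ℚ (X → ℚ)) (i : ι)
    (hU : ∀ u ∈ U, Matrix.toLin' (H.adj ℚ i) u ∈ U) :
    ∃ t : ℤ, LinearMap.trace ℚ U ((Matrix.toLin' (H.adj ℚ i)).restrict hU)
      = H.val i * Module.finrank ℚ U + (Fintype.card X : ℚ) * t := by
  have hq : qm (H.adj ℤ i - (H.val i : ℤ) • 1) = H.adj ℚ i - (H.val i : ℚ) • 1 := by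
    ext x y
    simp only [qm, HScheme.adj, Matrix.map_apply, Matrix.sub_apply,
      Matrix.smul_apply, Matrix.of_apply, Matrix.one_apply]
    split_ifs <;> simp
  have hA : ∀ u ∈ U, Matrix.toLin' (qm (H.adj ℤ i - (H.val i : ℤ) • 1)) u ∈ U := by
    intro u hu
    rw [hq, map_sub, LinearMap.sub_apply, map_smul, Matrix.toLin'_one]
    exact U.sub_mem (hU u hu) (U.smul_mem _ hu)
  obtain ⟨t, ht, hdvd⟩ := trace_int U _ hA
  obtain ⟨N, C, hNC⟩ := H.nil hp i
  obtain ⟨s, rfl⟩ := hdvd _ N C hp hNC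
  refine ⟨s, ?_⟩
  have h1 : (Matrix.toLin' (H.adj ℚ i)).restrict hU =
      (Matrix.toLin' (qm (H.adj ℤ i - (H.val i : ℤ) • 1))).restrict hA
        + (H.val i : ℚ) • LinearMap.id := by
    ext1 u
    apply Subtype.ext
    simp only [LinearMap.coe_restrict_apply, LinearMap.add_apply, LinearMap.smul_apply,
      LinearMap.id_apply, Submodule.coe_add, Submodule.coe_smul]
    rw [hq, map_sub, LinearMap.sub_apply, map_smul, Matrix.toLin'_one]
    simp
  rw [h1, map_add, ht, map_smul, LinearMap.trace_id]
  push_cast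
  rw [smul_eq_mul]
  ring

theorem trace_restrict_idem {e M : Matrix X X ℚ} (he : e * e = e) (hc : e * M = M * e)
    (hU : ∀ u ∈ LinearMap.range (Matrix.toLin' e), Matrix.toLin' M u ∈
      LinearMap.range (Matrix.toLin' e)) :
    LinearMap.trace ℚ (LinearMap.range (Matrix.toLin' e)) ((Matrix.toLin' M).restrict hU)
     = (e * M).trace := by
  have h1 : ∀ x, Matrix.toLin' (e * M) x ∈ LinearMap.range (Matrix.toLin' e) := by
    intro x
    rw [Matrix.toLin'_mul]
    exact ⟨_, rfl⟩
  have h2 : (Matrix.toLin' M).restrict hU = (Matrix.toLin' (e * M)).restrict (fun x _ => h1 x) := by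
    ext1 ⟨u, hu⟩
    apply Subtype.ext
    obtain ⟨v, rfl⟩ := hu
    simp [hc, mul_assoc, he]
  rw [h2, LinearMap.trace_restrict_eq_of_forall_mem _ _ h1, Matrix.trace_toLin'_eq]

theorem HScheme.central_idem (hp : (Fintype.card X).Prime) {e : Matrix X X ℚ}
    (hm : e ∈ H.coh ℚ) (he : e * e = e) (heJ : e * JM X ℚ = 0) (h0 : e ≠ 0)
    (hc : ∀ i, e * H.adj ℚ i = H.adj ℚ i * e) :
    e = 1 - (Fintype.card X : ℚ)⁻¹ • JM X ℚ := by
  have hJe : JM X ℚ * e = 0 := by rw [H.J_comm hm, heJ]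
  obtain ⟨f, hf⟩ := hm
  set p := Fintype.card X with hpd
  have hp0 : (p : ℚ) ≠ 0 := by exact_mod_cast hp.ne_zero
  set U := LinearMap.range (Matrix.toLin' e) with hU
  set d := Module.finrank ℚ U with hd
  have hdlt : d < p := rank_lt heJ
  have hinv : ∀ i, ∀ u ∈ U, Matrix.toLin' (H.adj ℚ i) u ∈ U := by
    rintro i _ ⟨v, rfl⟩
    refine ⟨Matrix.toLin' (H.adj ℚ i) v, ?_⟩
    rw [← Matrix.toLin'_mul_apply, hc, Matrix.toLin'_mul_apply]
  have hdpos : 0 < d := by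
    rw [Nat.pos_iff_ne_zero]
    intro h
    rw [hd, Submodule.finrank_eq_zero, hU, LinearMap.range_eq_bot] at h
    exact h0 (by simpa using h)
  have h1 : ∀ i, ∃ t : ℤ, f i = (d : ℚ) / p + (t : ℚ) / H.val i := by
    intro i
    obtain ⟨t, ht⟩ := H.trace_sub hp U (H.t i) (hinv _)
    rw [trace_restrict_idem he (hc _), H.trace_mul_adj hf, H.val_t] at ht
    refine ⟨t, ?_⟩
    have : (H.val i : ℚ) ≠ 0 := by exact_mod_cast (H.val_pos i).ne'
    field_simp
    linear_combination ht
  choose t ht using h1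
  set n := (p - 1).factorial with hn
  have hdvd : ∀ i, ∃ k : ℕ, n = H.val i * k := fun i =>
    Nat.dvd_factorial (H.val_pos i) (by have := H.val_lt hp.one_lt i; omega)
  choose k hk using hdvd
  -- integral matrix
  let M : Matrix X X ℤ := Matrix.of fun x y => k (H.c x y) * t (H.c x y)
  have hM : qm M = (n : ℚ) • e - ((n : ℚ) * d / p) • JM X ℚ := by
    ext x y
    simp only [qm, M, JM, Matrix.map_apply, Matrix.of_apply, Matrix.sub_apply, Matrix.smul_apply,
      hf, ht, smul_eq_mul, eq_intCast]
    have : (H.val (H.c x y) : ℚ) ≠ 0 := by exact_mod_cast (H.val_pos _).ne'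
    rw [hk (H.c x y)]
    push_cast
    field_simp
    ring
  have hM2 : qm (M * M - (n : ℤ) • M) = ((n : ℚ) ^ 2 * (d * (d + 1)) / p) • JM X ℚ := by
    have : qm (M * M - (n : ℤ) • M) = qm M * qm M - (n : ℚ) • qm M := by
      have h1 : qm (M * M - (n : ℤ) • M) = qm (M * M) - qm ((n : ℤ) • M) := by
        ext; simp [qm]
      have h2 : qm (M * M) = qm M * qm M := Matrix.map_mul
      have h3 : qm ((n : ℤ) • M) = (n : ℚ) • qm M := by
        ext x y
        simp only [qm, Matrix.map_apply, Matrix.smul_apply, smul_eq_mul]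
        simp
      rw [h1, h2, h3]
    rw [this, hM]
    simp only [sub_mul, mul_sub, smul_mul_assoc, mul_smul_comm, he, heJ, hJe, JJ, smul_zero,
      smul_sub, smul_smul]
    rw [← hpd]
    have : (n : ℚ) * d / p * (n * d / p * p) + n * (n * d / p) = n ^ 2 * (d * (d + 1)) / p := by
      field_simp
    rw [← this, add_smul]
    abel
  have hdiv : (p : ℤ) ∣ (n : ℤ) ^ 2 * (d * (d + 1)) := by
    let x : X := Classical.arbitrary X
    have := congrFun (congrFun hM2 x) x
    simp only [qm, JM, Matrix.map_apply, Matrix.smul_apply, Matrix.of_apply, smul_eq_mul,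
      mul_one, eq_intCast] at this
    rw [eq_div_iff hp0] at this
    exact ⟨(M * M - (n : ℤ) • M) x x, by rw [mul_comm (p : ℤ)]; exact_mod_cast this.symm⟩
  have hdp : d + 1 = p := by
    have h2 : p ∣ n ^ 2 * (d * (d + 1)) := by exact_mod_cast hdiv
    have hn' : ¬ p ∣ n := by
      rw [hn, hp.dvd_factorial]
      have := hp.pos
      omega
    rcases (hp.dvd_mul.1 h2) with h | h
    · exact absurd (hp.dvd_of_dvd_pow h) hn'
    · rcases (hp.dvd_mul.1 h) with h | h
      · exact absurd (Nat.le_of_dvd hdpos h) (by omega)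
      · have := Nat.le_of_dvd (by omega) h
        omega
  -- complement
  set g := 1 - e - (p : ℚ)⁻¹ • JM X ℚ with hg
  have hgg : g * g = g := by
    simp only [hg, sub_mul, mul_sub, smul_mul_assoc, mul_smul_comm, he, heJ, hJe, JJ, smul_zero,
      smul_smul, one_mul, mul_one]
    rw [← hpd, inv_mul_cancel₀ hp0, one_smul]; simp
  have htr : g.trace = 0 := by
    rw [hg, Matrix.trace_sub, Matrix.trace_sub, Matrix.trace_smul, Matrix.trace_one, trace_idem he,
      ← hU, ← hd, ← hpd]
    have : (JM X ℚ).trace = p := by simp [JM, Matrix.trace, hpd]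
    rw [this, smul_eq_mul, inv_mul_cancel₀ hp0, ← hdp]
    push_cast; ring
  rw [trace_idem hgg] at htr
  have h3 : g = 0 := by
    have : Module.finrank ℚ (LinearMap.range (Matrix.toLin' g)) = 0 := by exact_mod_cast htr
    rw [Submodule.finrank_eq_zero, LinearMap.range_eq_bot] at this
    simpa using this
  have h4 : e = 1 - (p : ℚ)⁻¹ • JM X ℚ - g := by rw [hg]; abel
  rw [h4, h3, sub_zero]

end idem

section abs
variable {W : Type*} [AddCommGroup W] [Module ℚ W] [FiniteDimensional ℚ W]

theorem trace_fun {S : Type*} [AddCommGroup S] [Module ℚ S] [FiniteDimensional ℚ S]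
    (k : ℕ) (g : S →ₗ[ℚ] S) :
    LinearMap.trace ℚ (Fin k → S) (g.compLeft (Fin k)) = k * LinearMap.trace ℚ S g := by
  let b := Module.finBasis ℚ S
  rw [LinearMap.trace_eq_matrix_trace ℚ (Pi.basis fun _ : Fin k => b),
    LinearMap.trace_eq_matrix_trace ℚ b]
  simp only [Matrix.trace, Matrix.diag, LinearMap.toMatrix_apply, Fintype.sum_sigma]
  have : ∀ (i : Fin k) j, ((Pi.basis fun _ : Fin k => b).repr
      ((g.compLeft (Fin k)) ((Pi.basis fun _ : Fin k => b) ⟨i, j⟩))) ⟨i, j⟩ =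
      b.repr (g (b j)) j := by
    intro i j
    rw [Pi.basis_repr]
    rw [Pi.basis_apply]
    change (b.repr (g ((Pi.single i (b j) : Fin k → S) i))) j = _
    rw [Pi.single_eq_same]
  rw [Finset.sum_congr rfl fun i _ => Finset.sum_congr rfl fun j _ => this i j]
  simp

theorem abs_main (A : Subalgebra ℚ (Module.End ℚ W)) (B : LinearMap.BilinForm ℚ W)
    (hs : B.IsSymm) (hpos : ∀ v, B v v = 0 → v = 0)
    (ad : Module.End ℚ W → Module.End ℚ W) (had : ∀ f u v, B (f u) v = B u (ad f v))
    (hadA : ∀ a ∈ A, ad a ∈ A) (hadA' : ∀ a ∈ A, ∃ b ∈ A, ad b = a)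
    (j : Module.End ℚ W) (hjc : ∀ a ∈ A, j * a = a * j) (hjA : j ∈ A)
    (w : W) (hw : w ≠ 0) (hjw : j w = 0) :
    ∃ (P : Module.End ℚ W) (S : Submodule ℚ W) (k : ℕ), P ∈ A ∧ P * P = P ∧ j * P = 0 ∧ P ≠ 0 ∧
      (∀ a ∈ A, P * a = a * P) ∧ S ≠ ⊥ ∧ (∀ v ∈ S, j v = 0) ∧
      (∀ v ∈ S, v ≠ 0 → ∀ u ∈ S, ∃ a ∈ A, a v = u) ∧
      Module.finrank ℚ (LinearMap.range P) = k * Module.finrank ℚ S ∧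
      ∃ hS : (∀ a ∈ A, ∀ s ∈ S, a s ∈ S),
      ∀ a (ha : a ∈ A), LinearMap.trace ℚ W (P * a) =
        k * LinearMap.trace ℚ S (a.restrict (hS a ha)) := by
  have hB : ∀ u v, B u v = B v u := fun u v => hs.eq u v
  -- orthogonal complements
  have compl : ∀ U : Submodule ℚ W, IsCompl U (B.orthogonal U) := by
    intro U
    rw [LinearMap.BilinForm.isCompl_orthogonal_iff_disjoint hs.isRefl]
    rw [Submodule.disjoint_def]
    intro x hx hx'
    exact hpos x (hx' x hx)
  let perp : Submodule A W → Submodule A W := fun N =>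
    { carrier := {v | ∀ u ∈ N, B u v = 0}
      add_mem' := fun {x y} hx hy u hu => by rw [map_add, hx u hu, hy u hu, add_zero]
      zero_mem' := fun u hu => by simp
      smul_mem' := fun a v hv u hu => by
        change B u (a.1 v) = 0
        rw [hB, had, hB]
        exact hv _ (N.smul_mem (⟨ad a.1, hadA _ a.2⟩ : A) hu) }
  have hperp : ∀ N : Submodule A W, IsCompl N (perp N) := by
    intro N
    have h := compl (N.restrictScalars ℚ)
    constructor
    · rw [Submodule.disjoint_def]
      intro x hx hx'
      exact hpos x (hx' x hx)
    · rw [codisjoint_iff, eq_top_iff]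
      intro x _
      have hx : x ∈ (N.restrictScalars ℚ) ⊔ B.orthogonal (N.restrictScalars ℚ) := by
        rw [h.sup_eq_top]; trivial
      obtain ⟨y, hy, z, hz, rfl⟩ := Submodule.mem_sup.1 hx
      exact Submodule.mem_sup.2 ⟨y, hy, z, fun u hu => hz u hu, rfl⟩
  have : IsSemisimpleModule A W := by
    rw [isSemisimpleModule_iff]
    exact ⟨fun N => ⟨_, hperp N⟩⟩
  have : Module.Finite A W := Module.Finite.of_restrictScalars_finite ℚ A W
  let K : Submodule A W :=
    { carrier := {v | j v = 0}
      add_mem' := fun {x y} hx hy => by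
        change j (x + y) = 0
        rw [map_add, hx, hy, add_zero]
      zero_mem' := map_zero j
      smul_mem' := fun a v hv => by
        change (j * a.1) v = 0
        rw [hjc _ a.2]
        change a.1 (j v) = 0
        rw [show j v = 0 from hv, map_zero] }
  obtain ⟨S, hSK, hSs⟩ : ∃ m ≤ K, IsSimpleModule A m := by
    rcases IsSemisimpleModule.eq_bot_or_exists_simple_le K with h | h
    · exfalso
      have : w ∈ K := hjw
      rw [h] at this
      exact hw this
    · exact h
  let N := isotypicComponent A W S
  have hNiso : IsIsotypicOfType A N S := IsIsotypicOfType.isotypicComponent A W S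
  have hNinv : N.IsFullyInvariant := Submodule.IsFullyInvariant.isotypicComponent A W S
  have hNK : N ≤ K := by
    refine sSup_le ?_
    rintro M ⟨e⟩ x hx
    change j x = 0
    have h1 : (⟨j, hjA⟩ : A) • (⟨x, hx⟩ : M) = 0 := by
      apply e.injective
      rw [map_smul, map_zero]
      apply Subtype.ext
      exact hSK (e ⟨x, hx⟩).2
    exact congrArg Subtype.val h1
  have hSN : S ≤ N := Submodule.le_isotypicComponent S
  let Q : W →ₗ[A] W := N.projection (perp N) (hperp N)
  have hQN : ∀ x ∈ N, Q x = x := fun x hx => Submodule.projection_apply_left (hperp N) ⟨x, hx⟩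
  have hQm : ∀ x, Q x ∈ N := fun x => Submodule.projection_apply_mem (hperp N) x
  have hQs : ∀ x, x - Q x ∈ perp N := fun x => Submodule.sub_projection_mem (hperp N) x
  have hQ0 : ∀ x ∈ perp N, Q x = 0 := fun x hx =>
    Submodule.projection_apply_right (hperp N) ⟨x, hx⟩
  let P : Module.End ℚ W := Q.restrictScalars ℚ
  -- Q commutes with the centralizer
  have hcomm : ∀ (f : Module.End A W) x, Q (f x) = f (Q x) := by
    intro f x
    let g : Module.End A W :=
      { toFun := ad (f.restrictScalars ℚ)
        map_add' := map_add _
        map_smul' := fun a v => by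
          obtain ⟨b, hb, hba⟩ := hadA' a.1 a.2
          change ad (f.restrictScalars ℚ) (a.1 v) = a.1 (ad (f.restrictScalars ℚ) v)
          have : ∀ u, B u (ad (f.restrictScalars ℚ) (a.1 v) - a.1 (ad (f.restrictScalars ℚ) v)) = 0 := by
            intro u
            rw [map_sub, ← had, ← hba, ← had, ← had, ← had, sub_eq_zero]
            have h2 := f.map_smul (⟨b, hb⟩ : A) u
            exact congrArg (fun t => B t v) h2.symm
          exact sub_eq_zero.1 (hpos _ (this _)) }
    have h1 : ∀ y ∈ perp N, f y ∈ perp N := by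
      intro y hy u hu
      rw [hB]
      have := had (f.restrictScalars ℚ) y u
      change B (f y) u = _ at this
      rw [this, hB]
      exact hy _ (hNinv g hu)
    have h2 : f x = f (Q x) + f (x - Q x) := by rw [← map_add]; simp
    rw [h2, map_add, hQN _ (hNinv f (hQm x)), hQ0 _ (h1 _ (hQs x)), add_zero]
  let Q' : Module.End (Module.End A W) W :=
    { toFun := Q
      map_add' := map_add Q
      map_smul' := fun f x => hcomm f x }
  have hPA : P ∈ A := by
    let b := Module.finBasis ℚ W
    obtain ⟨r, hr⟩ := jacobson_density Q' (Finset.univ.image b)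
    have : P = r.1 := by
      apply b.ext
      intro i
      exact hr (b i) (Finset.mem_image_of_mem _ (Finset.mem_univ _))
    rw [this]; exact r.2
  have hPP : P * P = P := by
    ext x
    exact hQN _ (hQm x)
  have hPc : ∀ a ∈ A, P * a = a * P := by
    intro a ha
    ext x
    exact Q.map_smul (⟨a, ha⟩ : A) x
  have hS' : ∀ a ∈ A, ∀ s ∈ S.restrictScalars ℚ, a s ∈ S.restrictScalars ℚ :=
    fun a ha s hs => S.smul_mem (⟨a, ha⟩ : A) hs
  have hN' : ∀ a ∈ A, ∀ s ∈ N.restrictScalars ℚ, a s ∈ N.restrictScalars ℚ :=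
    fun a ha s hs => N.smul_mem (⟨a, ha⟩ : A) hs
  have hSne : S ≠ ⊥ := by
    rintro h
    have := hSs.nontrivial
    rw [h] at this
    exact not_subsingleton _ (inferInstance : Subsingleton (⊥ : Submodule A W))
  have hrange : LinearMap.range P = N.restrictScalars ℚ := by
    ext x
    constructor
    · rintro ⟨y, rfl⟩
      exact hQm y
    · intro hx
      exact ⟨x, hQN x hx⟩
  obtain ⟨k, ⟨e⟩⟩ := hNiso.linearEquiv_fun
  let e' : (N.restrictScalars ℚ) ≃ₗ[ℚ] (Fin k → S.restrictScalars ℚ) :=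
    { toFun := fun x => e x
      invFun := fun y => e.symm y
      left_inv := fun x => e.symm_apply_apply x
      right_inv := fun x => e.apply_symm_apply x
      map_add' := fun x y => e.map_add x y
      map_smul' := fun c x => by
        have := e.map_smul (algebraMap ℚ A c) x
        exact this }
  refine ⟨P, S.restrictScalars ℚ, k, hPA, hPP, ?_, ?_, hPc, ?_, ?_, ?_, ?_, hS', ?_⟩
  · ext x
    exact hNK (hQm x)
  · intro h0
    apply hSne
    rw [eq_bot_iff]
    intro x hx
    have : P x = x := hQN x (hSN hx)
    rw [h0] at this
    exact this.symm
  · simpa using hSne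
  · intro v hv
    exact hSK hv
  · intro v hv hv0 u hu
    have h1 : (⟨v, hv⟩ : S) ≠ 0 := fun h => hv0 (congrArg Subtype.val h)
    obtain ⟨a, ha⟩ := IsSimpleModule.toSpanSingleton_surjective (M := S) A h1 ⟨u, hu⟩
    exact ⟨a.1, a.2, congrArg Subtype.val ha⟩
  · rw [hrange, e'.finrank_eq, Module.finrank_pi_fintype]
    simp
  · intro a ha
    have h1 : ∀ x, (P * a) x ∈ N.restrictScalars ℚ := fun x => hQm _
    rw [← trace_fun, ← LinearMap.trace_restrict_eq_of_forall_mem _ _ h1]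
    rw [← LinearMap.trace_conj' _ e']
    congr 1
    refine LinearMap.ext fun y => ?_
    rw [LinearEquiv.conj_apply_apply]
    have h2 := fun y' : Fin k → S => (e.map_smul (⟨a, ha⟩ : A) (e.symm y')).trans
      (congrArg _ (e.apply_symm_apply y'))
    refine Eq.trans ?_ (h2 y)
    change e _ = e _
    congr 1
    apply Subtype.ext
    exact hQN _ (hN' a ha _ (e.symm y).2)

end abs

section main
variable {X ι : Type*} [Fintype X] [DecidableEq X] [Fintype ι] [DecidableEq ι] [Nonempty X]


theorem HScheme.dvd (H : HScheme X ι) (hp : (Fintype.card X).Prime) :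
    (Fintype.card ι - 1) ∣ (Fintype.card X - 1) := by
  let A : Subalgebra ℚ (Module.End ℚ (X → ℚ)) :=
    (H.coh ℚ).comap (LinearMap.toMatrixAlgEquiv' : _ ≃ₐ[ℚ] Matrix X X ℚ).toAlgHom
  have memA : ∀ f, f ∈ A ↔ LinearMap.toMatrix' f ∈ H.coh ℚ := fun f => Iff.rfl
  have memA' : ∀ M : Matrix X X ℚ, M ∈ H.coh ℚ → Matrix.toLin' M ∈ A := fun M hM => by
    rw [memA, LinearMap.toMatrix'_toLin']; exact hM
  let B : LinearMap.BilinForm ℚ (X → ℚ) := dotProductBilin ℚ ℚ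
  have hB : ∀ u v, B u v = u ⬝ᵥ v := fun u v => rfl
  let ad : Module.End ℚ (X → ℚ) → Module.End ℚ (X → ℚ) :=
    fun f => Matrix.toLin' (LinearMap.toMatrix' f).transpose
  have hadA : ∀ a ∈ A, ad a ∈ A := fun a ha => memA' _ (H.transpose_mem ((memA a).1 ha))
  obtain ⟨x, y, hxy⟩ := Fintype.one_lt_card_iff.1 hp.one_lt
  obtain ⟨P, S, k, hPA, hPP, hjP, hP0, hPc, hSne, hSj, hSirr, hfin, hS, htr⟩ :=
    abs_main A B ⟨fun u v => by simp [hB, dotProduct_comm]⟩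
      (fun v hv => by
        rw [hB] at hv
        exact dotProduct_self_eq_zero.1 hv)
      ad (fun f u v => by
        rw [hB, hB, Matrix.toLin'_apply, Matrix.dotProduct_mulVec, Matrix.vecMul_transpose,
          ← Matrix.toLin'_apply, Matrix.toLin'_toMatrix'])
      hadA (fun a ha => ⟨ad a, hadA a ha, by simp [ad]⟩)
      (Matrix.toLin' (JM X ℚ)) (fun a ha => by
        have := H.J_comm ((memA a).1 ha)
        have := congrArg Matrix.toLin' this
        rwa [Matrix.toLin'_mul, Matrix.toLin'_mul, Matrix.toLin'_toMatrix'] at this)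
      (memA' _ H.J_mem) (Pi.single x 1 - Pi.single y 1) (fun h => by
        have := congrFun h x
        simp [hxy] at this) (by
        ext u
        rw [map_sub]
        simp [JM, Matrix.toLin'_apply])
  set e := LinearMap.toMatrix' P with he
  have hPe : P = Matrix.toLin' e := by rw [he, Matrix.toLin'_toMatrix']
  have heA : e ∈ H.coh ℚ := (memA P).1 hPA
  have hee : e * e = e := by
    rw [he, ← LinearMap.toMatrix'_mul, hPP]
  have hJe : JM X ℚ * e = 0 := by
    have := congrArg LinearMap.toMatrix' hjP
    rwa [LinearMap.toMatrix'_mul, LinearMap.toMatrix'_toLin', map_zero] at this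
  have he1 : e = 1 - (Fintype.card X : ℚ)⁻¹ • JM X ℚ := by
    refine H.central_idem hp heA hee ?_ ?_ ?_
    · rw [← H.J_comm heA, hJe]
    · intro h
      apply hP0
      rw [hPe, h, map_zero]
    · intro i
      have := congrArg LinearMap.toMatrix' (hPc _ (memA' _ (H.adj_mem i)))
      rwa [LinearMap.toMatrix'_mul, LinearMap.toMatrix'_mul, LinearMap.toMatrix'_toLin'] at this
  have hp0 : (Fintype.card X : ℚ) ≠ 0 := by exact_mod_cast hp.ne_zero
  have htJ : (JM X ℚ).trace = Fintype.card X := by simp [JM, Matrix.trace]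
  have hdim : k * Module.finrank ℚ S + 1 = Fintype.card X := by
    have h1 := trace_idem hee
    rw [← hPe, hfin, he1, Matrix.trace_sub, Matrix.trace_smul, Matrix.trace_one, htJ, smul_eq_mul,
      inv_mul_cancel₀ hp0] at h1
    have : ((k * Module.finrank ℚ S + 1 : ℕ) : ℚ) = Fintype.card X := by
      rw [Nat.cast_add, ← h1]; simp
    exact_mod_cast this
  have hkv : ∀ i, i ≠ H.z → k ≤ H.val i := by
    intro i hi
    have h1 := htr _ (memA' _ (H.adj_mem i))
    have h2 : LinearMap.trace ℚ (X → ℚ) (P * Matrix.toLin' (H.adj ℚ i)) = - (H.val i : ℚ) := by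
      rw [hPe, Module.End.mul_eq_comp, ← Matrix.toLin'_mul, Matrix.trace_toLin'_eq, he1, sub_mul,
        one_mul, Matrix.smul_mul, H.J_adj, Matrix.trace_sub, H.trace_adj hi, Matrix.trace_smul,
        Matrix.trace_smul, htJ]
      simp only [smul_eq_mul]
      field_simp
      simp
    have hq := qm_adj H i
    have h3 : ∀ u ∈ S, Matrix.toLin' (qm (H.adj ℤ i)) u ∈ S := by
      rw [hq]; exact hS _ (memA' _ (H.adj_mem i))
    obtain ⟨t, ht, -⟩ := trace_int S (H.adj ℤ i) h3
    simp only [hq] at ht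
    rw [h2, ht] at h1
    have h4 : - (H.val i : ℤ) = k * t := by exact_mod_cast h1
    have h5 : (k : ℤ) ∣ H.val i := ⟨-t, by linarith⟩
    exact Nat.le_of_dvd (H.val_pos i) (by exact_mod_cast h5)
  have hlow : (Fintype.card ι - 1) * k + 1 ≤ Fintype.card X := by
    rw [← H.sum_val, ← Finset.add_sum_erase _ _ (Finset.mem_univ H.z), H.val_z]
    have := Finset.card_nsmul_le_sum (Finset.univ.erase H.z) H.val k
      (fun i hi => hkv i (Finset.ne_of_mem_erase hi))
    rw [Finset.card_erase_of_mem (Finset.mem_univ _), Finset.card_univ, smul_eq_mul] at this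
    rw [add_comm]
    exact Nat.add_le_add_left this 1
  have hup : Module.finrank ℚ S + 1 ≤ Fintype.card ι := by
    obtain ⟨v, hv, hv0⟩ := (Submodule.ne_bot_iff S).1 hSne
    let φ : (ι → ℚ) →ₗ[ℚ] (X → ℚ) :=
      Fintype.linearCombination ℚ (fun i => Matrix.toLin' (H.adj ℚ i) v)
    have hφ : ∀ f, φ f = Matrix.toLin' (∑ i, f i • H.adj ℚ i) v := by
      intro f
      simp [φ, Fintype.linearCombination_apply, map_sum, Matrix.sum_mulVec, Matrix.smul_mulVec]
    have h1 : S ≤ LinearMap.range φ := by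
      intro u hu
      obtain ⟨a, ha, hau⟩ := hSirr v hv hv0 u hu
      obtain ⟨f, hf⟩ := (memA a).1 ha
      refine ⟨f, ?_⟩
      rw [hφ, ← H.mem_sum hf, Matrix.toLin'_toMatrix', hau]
    have h2 := LinearMap.finrank_range_add_finrank_ker φ
    have h3 := Submodule.finrank_mono h1
    have h4 : 0 < Module.finrank ℚ (LinearMap.ker φ) := by
      rw [Module.finrank_pos_iff, Submodule.nontrivial_iff_ne_bot, Submodule.ne_bot_iff]
      refine ⟨fun _ => 1, ?_, fun h => ?_⟩
      · rw [LinearMap.mem_ker, hφ, ← H.mem_sum (M := JM X ℚ) (fun _ _ => rfl)]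
        exact hSj v hv
      · have := congrFun h H.z
        simp at this
    rw [Module.finrank_fintype_fun_eq_card] at h2
    omega
  have hk : 0 < k := by
    rcases Nat.eq_zero_or_pos k with h | h
    · rw [h] at hdim
      have := hp.one_lt
      omega
    · exact h
  have h6 : Fintype.card ι - 1 = Module.finrank ℚ S := by
    apply le_antisymm
    · have : (Fintype.card ι - 1) * k ≤ Module.finrank ℚ S * k := by
        rw [mul_comm _ k, mul_comm _ k] at *
        omega
      exact Nat.le_of_mul_le_mul_right this hk
    · omega
  rw [h6]
  exact ⟨k, by rw [mul_comm]; omega⟩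

end main

end HS

theorem exists_hscheme {V : Type*} [Fintype V] (ℛ : Set (Set (V × V))) (h : IsCC ℛ) (X : Set V)
    (hX : IsFiber ℛ X) : Nonempty (HS.HScheme X (relsBtw ℛ X X)) := by
  obtain ⟨hne, hpart, hdiag, htr, hcc⟩ := h
  choose rel hrel huniq using hpart
  have hrm : ∀ p, rel p ∈ ℛ := fun p => (hrel p).1
  have hrp : ∀ p, p ∈ rel p := fun p => (hrel p).2
  have huq : ∀ p R, R ∈ ℛ → p ∈ R → R = rel p := fun p R h1 h2 => huniq p R ⟨h1, h2⟩
  have pos : ∀ (R S : Set (V × V)) p, (0 < iNum R S p ↔ ∃ w, (p.1, w) ∈ R ∧ (w, p.2) ∈ S) := by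
    intro R S p
    rw [iNum, Nat.card_pos_iff]
    constructor
    · rintro ⟨⟨w, hw⟩, -⟩
      exact ⟨w, hw⟩
    · rintro ⟨w, hw⟩
      exact ⟨⟨w, hw⟩, inferInstance⟩
  have hsub : ∀ x y, x ∈ X → y ∈ X → rel (x, y) ⊆ X ×ˢ X := by
    rintro x y hx hy ⟨a, b⟩ hab
    have h1 : 0 < iNum (diag X) (rel (x, y)) (x, y) := (pos _ _ _).2 ⟨x, ⟨hx, rfl⟩, hrp _⟩
    have h2 : 0 < iNum (rel (x, y)) (diag X) (x, y) := (pos _ _ _).2 ⟨y, hrp _, ⟨hy, rfl⟩⟩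
    rw [hcc _ hX.2 _ (hrm _) _ (hrm (x, y)) _ (hrp _) _ hab] at h1
    rw [hcc _ (hrm _) _ hX.2 _ (hrm (x, y)) _ (hrp _) _ hab] at h2
    obtain ⟨w, hw, -⟩ := (pos _ _ _).1 h1
    obtain ⟨w', -, hw', hw2⟩ := (pos _ _ _).1 h2
    refine ⟨hw.1, ?_⟩
    simp only at hw' hw2 ⊢
    rw [← hw2]; exact hw'
  have hkey : ∀ (R S : relsBtw ℛ X X) (x y : X),
      (Finset.univ.filter fun w : X => rel (x.1, w.1) = R.1 ∧ rel (w.1, y.1) = S.1).card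
        = iNum R.1 S.1 (x.1, y.1) := by
    intro R S x y
    rw [iNum, ← Fintype.card_subtype, ← Nat.card_eq_fintype_card]
    have hRiff : ∀ (R : relsBtw ℛ X X) a b, rel (a, b) = R.1 ↔ (a, b) ∈ R.1 := fun R a b =>
      ⟨fun h => h ▸ hrp _, fun h => (huq _ _ R.2.1 h).symm⟩
    refine Nat.card_congr
      { toFun := fun w => ⟨w.1.1, (hRiff R _ _).1 w.2.1, (hRiff S _ _).1 w.2.2⟩
        invFun := fun w => ⟨⟨w.1, (R.2.2 w.2.1).2⟩, (hRiff R _ _).2 w.2.1, (hRiff S _ _).2 w.2.2⟩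
        left_inv := fun w => rfl
        right_inv := fun w => rfl }
  refine ⟨{
    c := fun x y => ⟨rel (x.1, y.1), hrm _, hsub _ _ x.2 y.2⟩
    z := ⟨diag X, hX.2, fun p hp => ⟨hp.1, hp.2 ▸ hp.1⟩⟩
    t := fun R => ⟨transp R.1, htr _ R.2.1, fun p hp => ⟨(R.2.2 hp).2, (R.2.2 hp).1⟩⟩
    hz := ?_
    ht := ?_
    surj := ?_
    reg := ?_ }⟩
  · intro x y
    constructor
    · intro h
      have h : rel (x.1, y.1) = diag X := congrArg Subtype.val h
      have := hrp (x.1, y.1)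
      rw [h] at this
      exact Subtype.ext this.2
    · rintro rfl
      exact Subtype.ext (huq _ _ hX.2 ⟨x.2, rfl⟩).symm
  · intro x y
    apply Subtype.ext
    exact (huq _ _ (htr _ (hrm _)) (hrp (x.1, y.1))).symm
  · rintro ⟨R, hR, hR2⟩
    obtain ⟨⟨a, b⟩, hab⟩ := hne R hR
    exact ⟨⟨a, (hR2 hab).1⟩, ⟨b, (hR2 hab).2⟩, Subtype.ext (huq _ _ hR hab).symm⟩
  · intro R S x y x' y' h
    have h := congrArg Subtype.val h
    simp only at h
    simp only [Subtype.ext_iff]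
    rw [hkey, hkey]
    exact hcc _ R.2.1 _ S.2.1 _ (hrm (x.1, y.1)) _ (hrp _) _ (by rw [h]; exact hrp _)

/-- **Theorem (Statement 18).** For an `(m,n,r)`-scheme with `r ≥ 1`, if `m` is prime
then `r - 1` divides `m - 1`. -/
theorem prime_m_r_sub_one_dvd
    {V : Type*} [Fintype V] [Nonempty V]
    (ℛ : Set (Set (V × V))) (m n r : ℕ) (h : IsMNRScheme ℛ m n r)
    (hr : 1 ≤ r) (hm : m.Prime) :
    (r - 1) ∣ (m - 1) := by
  obtain ⟨hcc, hbal, hsz, -⟩ := h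
  obtain ⟨v⟩ := ‹Nonempty V›
  obtain ⟨D, ⟨hD, hvD⟩, -⟩ := hcc.2.1 (v, v)
  have hd : diag {x | (x, x) ∈ D} = D := by
    ext ⟨a, b⟩
    constructor
    · rintro ⟨h1, h2⟩
      simp only at h2
      subst h2
      exact h1
    · intro hab
      have h2 : a = b := hcc.2.2.1 D hD ⟨_, hvD, rfl⟩ _ hab
      subst h2
      exact ⟨hab, rfl⟩
  have hX : IsFiber ℛ {x | (x, x) ∈ D} := ⟨⟨v, hvD⟩, by rw [hd]; exact hD⟩
  obtain ⟨H⟩ := exists_hscheme ℛ hcc _ hX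
  have h1 := hsz _ hX
  have h2 := hbal _ _ hX hX
  rw [Nat.card_eq_fintype_card] at h1 h2
  haveI : Nonempty {x | (x, x) ∈ D} := ⟨⟨v, hvD⟩⟩
  have := H.dvd (by rw [h1]; exact hm)
  rwa [h1, h2] at this

end CCPaper
end
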